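/- MPL is expressively equivalent to Counting-CTL* (CCTL*), and WMPL is expressively equivalent to Weak Counting-CTL* (WCCTL*), over the class of Kripke trees: every sentence of the one logic has a sentence of the other satisfied by exactly the same Kripke trees. -/

import Mathlib

/-! ## Trees over ℕ* -/

abbrev Node : Type := List ℕ

/-- `T` is a tree with root `r`: `r ∈ T`, every node extends `r`, and `T` is
prefix-closed above `r`. -/
def IsTreeRooted (T : Set Node) (r : Node) : Prop :=
  r ∈ T ∧ (∀ τ ∈ T, r <+: τ) ∧
    ∀ σ σ' : List ℕ, r ++ σ ∈ T → σ' <+: σ → r ++ σ' ∈ T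

/-- `T ⊆ ℕ*` is a tree. -/
def IsTree (T : Set Node) : Prop := ∃ r : Node, IsTreeRooted T r

/-- `τ'` is a child of `τ` in `T`. -/
def childIn (T : Set Node) (τ τ' : Node) : Prop := τ' ∈ T ∧ ∃ n : ℕ, τ' = τ ++ [n]

/-- every node of `T` has a child in `T`. -/
def NonBlocking (T : Set Node) : Prop := ∀ τ ∈ T, ∃ n : ℕ, τ ++ [n] ∈ T

/-- every node of `T` has finitely many children in `T`. -/
def FinBranching (T : Set Node) : Prop := ∀ τ ∈ T, {τ' : Node | childIn T τ τ'}.Finite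

/-- `S` is a subtree of `T`. -/
def IsSubtree (T S : Set Node) : Prop := S ⊆ T ∧ IsTree S

/-- `P` is a path of `T`: a subtree totally ordered by the child relation
(each node has at most one child in `P`). -/
def IsPathOf (T P : Set Node) : Prop :=
  IsSubtree T P ∧ ∀ τ ∈ P, ∀ n m : ℕ, τ ++ [n] ∈ P → τ ++ [m] ∈ P → n = m

/-- `T` is a chain: a tree in which each node has at most one child. -/
def IsChainTree (T : Set Node) : Prop :=
  IsTree T ∧ ∀ τ ∈ T, ∀ n m : ℕ, τ ++ [n] ∈ T → τ ++ [m] ∈ T → n = m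

/-- `T` is dense: it contains a subtree every node of which has a descendant
in the subtree with at least two distinct children in the subtree. -/
def DenseTree (T : Set Node) : Prop :=
  ∃ S : Set Node, IsSubtree T S ∧ ∀ τ ∈ S, ∃ τ' ∈ S, τ <+: τ' ∧
    ∃ n m : ℕ, n ≠ m ∧ τ' ++ [n] ∈ S ∧ τ' ++ [m] ∈ S

/-- A Kripke tree over `AP`: a non-blocking tree together with a labelling. -/
structure KripkeTree (AP : Type) where
  T : Set Node
  root : Node
  rooted : IsTreeRooted T root
  nonblocking : NonBlocking T
  Lab : Node → Set AP

/-! ## MSOL syntax -/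

inductive MSOL (AP : Type) : Type
  | atom : AP → ℕ → MSOL AP          -- P_a(x)
  | le   : ℕ → ℕ → MSOL AP           -- x ≤ y
  | mem  : ℕ → ℕ → MSOL AP           -- x ∈ X
  | not  : MSOL AP → MSOL AP
  | and  : MSOL AP → MSOL AP → MSOL AP
  | exFO : ℕ → MSOL AP → MSOL AP     -- ∃x. φ
  | exSO : ℕ → MSOL AP → MSOL AP     -- ∃X. φ

namespace MSOL

def freeFO {AP : Type} : MSOL AP → Set ℕ
  | atom _ x => {x}
  | le x y => {x, y}
  | mem x _ => {x}
  | not φ => φ.freeFO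
  | and φ ψ => φ.freeFO ∪ ψ.freeFO
  | exFO x φ => φ.freeFO \ {x}
  | exSO _ φ => φ.freeFO

def freeSO {AP : Type} : MSOL AP → Set ℕ
  | atom _ _ => ∅
  | le _ _ => ∅
  | mem _ X => {X}
  | not φ => φ.freeSO
  | and φ ψ => φ.freeSO ∪ ψ.freeSO
  | exFO _ φ => φ.freeSO
  | exSO X φ => φ.freeSO \ {X}

/-- A sentence is a formula with no free variables. -/
def IsSentence {AP : Type} (φ : MSOL AP) : Prop := φ.freeFO = ∅ ∧ φ.freeSO = ∅

/-- The first-order fragment: no second-order variables. -/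
def IsFO {AP : Type} : MSOL AP → Prop
  | atom _ _ => True
  | le _ _ => True
  | mem _ _ => False
  | not φ => φ.IsFO
  | and φ ψ => φ.IsFO ∧ ψ.IsFO
  | exFO _ φ => φ.IsFO
  | exSO _ _ => False

end MSOL

/-! ## MSOL semantics, parametrized by the range of second-order quantifiers -/

/-- A second-order domain: for each tree, the collection of sets that
second-order quantifiers range over. -/
abbrev SODom : Type := Set Node → Set (Set Node)

def Sat {AP : Type} (D : SODom) (K : KripkeTree AP) :
    (ℕ → Node) → (ℕ → Set Node) → MSOL AP → Prop
  | V1, _,  .atom a x => V1 x ∈ K.T ∧ a ∈ K.Lab (V1 x)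
  | V1, _,  .le x y => V1 x ∈ K.T ∧ V1 y ∈ K.T ∧ V1 x <+: V1 y
  | V1, V2, .mem x X => V1 x ∈ V2 X
  | V1, V2, .not φ => ¬ Sat D K V1 V2 φ
  | V1, V2, .and φ ψ => Sat D K V1 V2 φ ∧ Sat D K V1 V2 ψ
  | V1, V2, .exFO x φ => ∃ τ ∈ K.T, Sat D K (Function.update V1 x τ) V2 φ
  | V1, V2, .exSO X φ => ∃ S ∈ D K.T, Sat D K V1 (Function.update V2 X S) φ

/-- A logic: a syntactic fragment of MSOL together with a second-order domain. -/
structure MLogic (AP : Type) where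
  syn : MSOL AP → Prop
  dom : SODom

namespace MLogic

/-- A Kripke tree satisfies a sentence. -/
def KSat {AP : Type} (L : MLogic AP) (K : KripkeTree AP) (φ : MSOL AP) : Prop :=
  ∃ V1 V2, Sat L.dom K V1 V2 φ

/-- `L ≤ L'` over the class `M`. -/
def Leq {AP : Type} (M : Set (KripkeTree AP)) (L L' : MLogic AP) : Prop :=
  ∀ φ : MSOL AP, φ.IsSentence → L.syn φ →
    ∃ φ' : MSOL AP, φ'.IsSentence ∧ L'.syn φ' ∧
      ∀ K ∈ M, (L.KSat K φ ↔ L'.KSat K φ')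

/-- `L < L'` over the class `M`. -/
def Lt {AP : Type} (M : Set (KripkeTree AP)) (L L' : MLogic AP) : Prop :=
  Leq M L L' ∧ ¬ Leq M L' L

/-- `L ≡ L'` over the class `M`. -/
def EquivExp {AP : Type} (M : Set (KripkeTree AP)) (L L' : MLogic AP) : Prop :=
  Leq M L L' ∧ Leq M L' L

/-- `L` and `L'` are expressively incomparable over the class `M`. -/
def Incomp {AP : Type} (M : Set (KripkeTree AP)) (L L' : MLogic AP) : Prop :=
  ¬ Leq M L L' ∧ ¬ Leq M L' L

end MLogic

/-! ## The concrete logics -/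

def MSOdom : SODom := fun T => {S | S ⊆ T}
def MTLdom : SODom := fun T => {S | S ⊆ T ∧ IsTree S}
def MPLdom : SODom := fun T => {S | IsPathOf T S}
def weakDom (D : SODom) : SODom := fun T => {S | S ∈ D T ∧ S.Finite}
def coweakDom (D : SODom) : SODom := fun T => {S | S ∈ D T ∧ S.Infinite}

def MSO (AP : Type) : MLogic AP := ⟨fun _ => True, MSOdom⟩
def MTL (AP : Type) : MLogic AP := ⟨fun _ => True, MTLdom⟩
def MPL (AP : Type) : MLogic AP := ⟨fun _ => True, MPLdom⟩
def WMSO (AP : Type) : MLogic AP := ⟨fun _ => True, weakDom MSOdom⟩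
def WMTL (AP : Type) : MLogic AP := ⟨fun _ => True, weakDom MTLdom⟩
def WMPL (AP : Type) : MLogic AP := ⟨fun _ => True, weakDom MPLdom⟩
def CoWMSO (AP : Type) : MLogic AP := ⟨fun _ => True, coweakDom MSOdom⟩
def CoWMTL (AP : Type) : MLogic AP := ⟨fun _ => True, coweakDom MTLdom⟩
def CoWMPL (AP : Type) : MLogic AP := ⟨fun _ => True, coweakDom MPLdom⟩
def FOL (AP : Type) : MLogic AP := ⟨MSOL.IsFO, MSOdom⟩

/-! ## Classes of Kripke trees -/

def allKT (AP : Type) : Set (KripkeTree AP) := Set.univ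
def finBrKT (AP : Type) : Set (KripkeTree AP) := {K | FinBranching K.T}
/-- Kripke trees whose underlying tree is an infinite chain
(every node has exactly one child). -/
def chainKT (AP : Type) : Set (KripkeTree AP) :=
  {K | ∀ τ ∈ K.T, ∃! τ' : Node, childIn K.T τ τ'}

/-! ## Counting-CTL* -/

/-- A (finite or infinite) path, written as a word: a length in `ℕ∞` and a
sequence of nodes (only positions `< len` are relevant). -/
structure PathW where
  len : ℕ∞
  seq : ℕ → Node

/-- `π` is a path of `T` (viewed as a word): nonempty, all its positions are
nodes of `T`, and consecutive positions are in the child relation. -/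
def ValidPath (T : Set Node) (π : PathW) : Prop :=
  0 < π.len ∧
  (∀ i : ℕ, (i : ℕ∞) < π.len → π.seq i ∈ T) ∧
  (∀ i : ℕ, ((i + 1 : ℕ) : ℕ∞) < π.len → ∃ n : ℕ, π.seq (i + 1) = π.seq i ++ [n])

mutual
  /-- CCTL* state formulas. -/
  inductive CState (AP : Type) : Type
    | tt  : CState AP
    | atom : AP → CState AP
    | not : CState AP → CState AP
    | and : CState AP → CState AP → CState AP
    | E   : CPath AP → CState AP
    | D   : ℕ → CState AP → CState AP   -- counting operator D^n
  /-- CCTL* path formulas. -/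
  inductive CPath (AP : Type) : Type
    | st  : CState AP → CPath AP
    | not : CPath AP → CPath AP
    | and : CPath AP → CPath AP → CPath AP
    | X   : CPath AP → CPath AP
    | U   : CPath AP → CPath AP → CPath AP
end

mutual
  /-- Satisfaction of CCTL* state formulas at a node; `PR` restricts the
  lengths of the paths the quantifier `E` ranges over (all/finite/infinite). -/
  def csat {AP : Type} (PR : ℕ∞ → Prop) (K : KripkeTree AP) :
      CState AP → Node → Prop
    | .tt, _ => True
    | .atom a, τ => a ∈ K.Lab τ
    | .not φ, τ => ¬ csat PR K φ τ
    | .and φ ψ, τ => csat PR K φ τ ∧ csat PR K ψ τ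
    | .E ψ, τ => ∃ π : PathW, ValidPath K.T π ∧ PR π.len ∧ π.seq 0 = τ ∧
        cpsat PR K ψ π 0
    | .D n φ, τ => ∃ F : Finset Node, F.card = n ∧
        ∀ τ' ∈ F, childIn K.T τ τ' ∧ csat PR K φ τ'
  /-- Satisfaction of CCTL* path formulas at a position of a path. -/
  def cpsat {AP : Type} (PR : ℕ∞ → Prop) (K : KripkeTree AP) :
      CPath AP → PathW → ℕ → Prop
    | .st φ, π, i => csat PR K φ (π.seq i)
    | .not ψ, π, i => ¬ cpsat PR K ψ π i
    | .and ψ ψ', π, i => cpsat PR K ψ π i ∧ cpsat PR K ψ' π i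
    | .X ψ, π, i => ((i + 1 : ℕ) : ℕ∞) < π.len ∧ cpsat PR K ψ π (i + 1)
    | .U ψ ψ', π, i => ∃ j : ℕ, i ≤ j ∧ (j : ℕ∞) < π.len ∧ cpsat PR K ψ' π j ∧
        ∀ k : ℕ, i ≤ k → k < j → cpsat PR K ψ π k
end

/-- A Kripke tree satisfies a CCTL* state formula iff it holds at the root. -/
def CKSat {AP : Type} (PR : ℕ∞ → Prop) (K : KripkeTree AP) (φ : CState AP) : Prop :=
  csat PR K φ K.root

/-- Path-length restriction of full CCTL*: all paths. -/
def fullPR : ℕ∞ → Prop := fun _ => True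
/-- Path-length restriction of Weak CCTL*: finite paths. -/
def weakPR : ℕ∞ → Prop := fun l => l ≠ ⊤
/-- Path-length restriction of coWeak CCTL*: infinite paths. -/
def coweakPR : ℕ∞ → Prop := fun l => l = ⊤

section Kamp
/-! ## Abstract temporal closure: iterated transformations -/

inductive Reach {S Q : Type} (next : S → Option S) (f : S → Option (Q → Q)) (γ : Set S) :
    Q → Q → S → Prop
  | base {q : Q} {s : S} : s ∈ γ → Reach next f γ q q s
  | step {p q : Q} {s s' : S} {g : Q → Q} : f s = some g → next s = some s' →
      Reach next f γ (g p) q s' → Reach next f γ p q s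

inductive Unt {S : Type} (next : S → Option S) (P R : Set S) : S → Prop
  | base {s : S} : s ∈ R → Unt next P R s
  | step {s s' : S} : s ∈ P → next s = some s' → Unt next P R s' → Unt next P R s

inductive First {S : Type} (next : S → Option S) (D : Set S) : S → S → Prop
  | here {s : S} : s ∈ D → First next D s s
  | there {s s' r : S} : s ∉ D → next s = some s' → First next D s' r → First next D s r

/-- A set of transformations forming a monoid. -/
structure IsMon {Q : Type} (N : Set (Q → Q)) : Prop where
  one : id ∈ N
  mul : ∀ g h, g ∈ N → h ∈ N → g ∘ h ∈ N

structure TClosed {S : Type} (next : S → Option S) (C : Set (Set S)) : Prop where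
  univ : Set.univ ∈ C
  compl : ∀ P, P ∈ C → Pᶜ ∈ C
  inter : ∀ P R, P ∈ C → R ∈ C → P ∩ R ∈ C
  nxt : ∀ P, P ∈ C → {s | ∃ s', next s = some s' ∧ s' ∈ P} ∈ C
  unt : ∀ P R, P ∈ C → R ∈ C → {s | Unt next P R s} ∈ C

namespace TClosed
variable {S : Type} {next : S → Option S} {C : Set (Set S)}

theorem union' (h : TClosed next C) {P R : Set S} (hP : P ∈ C) (hR : R ∈ C) : P ∪ R ∈ C := by
  have := h.compl _ (h.inter _ _ (h.compl _ hP) (h.compl _ hR))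
  rwa [Set.compl_inter, compl_compl, compl_compl] at this

theorem empty' (h : TClosed next C) : ∅ ∈ C := by simpa using h.compl _ h.univ

theorem iInter' (h : TClosed next C) {ι : Type} [Finite ι] (P : ι → Set S) (hP : ∀ i, P i ∈ C) : (⋂ i, P i) ∈ C := by
  classical
  have := Fintype.ofFinite ι
  have key : ∀ t : Finset ι, (⋂ i ∈ t, P i) ∈ C := by
    intro t
    induction t using Finset.induction_on with
    | empty => simpa using h.univ
    | insert a t _ ih => rw [Finset.set_biInter_insert]; exact h.inter _ _ (hP a) ih
  simpa using key Finset.univ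

theorem iUnion' (h : TClosed next C) {ι : Type} [Finite ι] (P : ι → Set S) (hP : ∀ i, P i ∈ C) : (⋃ i, P i) ∈ C := by
  have := h.compl _ (h.iInter' (fun i => (P i)ᶜ) (fun i => h.compl _ (hP i)))
  simpa [Set.compl_iInter] using this

theorem const' (h : TClosed next C) (p : Prop) : {_s : S | p} ∈ C := by
  by_cases hp : p
  · simpa [hp] using h.univ
  · simpa [hp] using h.empty'

end TClosed

section
variable {S Q : Type} {next : S → Option S} {f f1 : S → Option (Q → Q)}

theorem Reach.mono {γ : Set S} {p q : Q} {s : S} (hf : ∀ s g, f1 s = some g → f s = some g)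
    (h : Reach next f1 γ p q s) : Reach next f γ p q s := by
  induction h with
  | base h => exact .base h
  | step h1 h2 _ ih => exact .step (hf _ _ h1) h2 ih

theorem Reach.trans {G γ : Set S} {p r q : Q} {s : S}
    (h : Reach next f G p r s) (hG : ∀ s' ∈ G, Reach next f γ r q s') :
    Reach next f γ p q s := by
  induction h with
  | base h => exact hG _ h
  | step h1 h2 _ ih => exact .step h1 h2 (ih hG)

theorem Reach.exists_end {γ : Set S} {N : Set (Q → Q)} (hM : IsMon N)
    (hN : ∀ s g, f s = some g → g ∈ N) {p q : Q} {s : S}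
    (h : Reach next f γ p q s) :
    ∃ e ∈ γ, ∃ g ∈ N, q = g p ∧ (∀ q0, Reach next f {e} q0 (g q0) s) ∧
      ∀ D : Set S, (∀ s ∈ D, f s = none) → e ∈ D → First next D s e := by
  induction h with
  | @base q s h =>
    exact ⟨s, h, id, hM.one, rfl, fun q0 => .base rfl, fun D _ he => .here he⟩
  | @step p q s s' g h1 h2 _ ih =>
    obtain ⟨e, he, g', hg', e1, e2, e3⟩ := ih
    refine ⟨e, he, g' ∘ g, hM.mul _ _ hg' (hN _ _ h1), e1, fun q0 => ?_, fun D hD heD => ?_⟩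
    · exact .step h1 h2 (e2 (g q0))
    · refine .there (fun hs => ?_) h2 (e3 D hD heD)
      rw [hD s hs] at h1; cases h1

theorem First.mem {D : Set S} {s r : S} (h : First next D s r) : r ∈ D := by
  induction h with
  | here h => exact h
  | there _ _ _ ih => exact ih

theorem First.unique {D : Set S} {s r r' : S} (h : First next D s r) (h' : First next D s r') :
    r = r' := by
  induction h with
  | here h =>
    cases h' with
    | here => rfl
    | there h1 => exact absurd h h1
  | there h1 h2 _ ih =>
    cases h' with
    | here h => exact absurd h h1
    | there h3 h4 h5 =>
      rw [h2] at h4; cases h4; exact ih h5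

theorem Reach.unique {D : Set S} (hD : ∀ s ∈ D, f s = none) {p q q' : Q} {s : S}
    (h : Reach next f D p q s) (h' : Reach next f D p q' s) : q = q' := by
  induction h with
  | base h =>
    cases h' with
    | base => rfl
    | step h1 => rw [hD _ h] at h1; cases h1
  | step h1 h2 _ ih =>
    cases h' with
    | base h => rw [hD _ h] at h1; cases h1
    | step h3 h4 h5 =>
      rw [h2] at h4; cases h4
      rw [h1] at h3; cases h3
      exact ih h5

theorem unt_first {D P : Set S} (hP : P ⊆ D) {t : S} :
    Unt next Dᶜ P t ↔ ∃ r ∈ P, First next D t r := by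
  constructor
  · intro h
    induction h with
    | base h => exact ⟨_, h, .here (hP h)⟩
    | step h1 h2 _ ih =>
      obtain ⟨r, hr, h⟩ := ih
      exact ⟨r, hr, .there h1 h2 h⟩
  · rintro ⟨r, hr, h⟩
    induction h with
    | here h => exact .base hr
    | there h1 h2 _ ih => exact .step h1 h2 (ih hr)

open Classical in
/-- jump to the next element of `D` -/
noncomputable def jump (next : S → Option S) (D : Set S) (s : D) : Option D :=
  if h : ∃ r, ∃ t, next s = some t ∧ First next D t r then
    some ⟨h.choose, h.choose_spec.choose_spec.2.mem⟩ else none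

theorem jump_eq {D : Set S} {s r : D} :
    jump next D s = some r ↔ ∃ t, next s = some t ∧ First next D t r := by
  unfold jump
  split_ifs with h
  · obtain ⟨t, h1, h2⟩ := h.choose_spec
    constructor
    · intro e
      cases e
      exact ⟨t, h1, h2⟩
    · rintro ⟨t', h3, h4⟩
      rw [h1] at h3; cases h3
      congr 1
      exact Subtype.ext (h2.unique h4)
  · constructor
    · intro e; cases e
    · intro h'; exact absurd ⟨_, h'⟩ h

theorem jump_closed {C : Set (Set S)} (hC : TClosed next C) {D : Set S} (hD : D ∈ C) :
    TClosed (jump next D) {P : Set D | Subtype.val '' P ∈ C} := by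
  refine ⟨?_, ?_, ?_, ?_, ?_⟩
  · simpa using hD
  · intro P hP
    have : Subtype.val '' Pᶜ = D ∩ (Subtype.val '' P)ᶜ := by
      ext s; constructor
      · rintro ⟨s, hs, rfl⟩
        refine ⟨s.2, ?_⟩
        rintro ⟨s', hs', e⟩
        exact hs (Subtype.ext e ▸ hs')
      · rintro ⟨h1, h2⟩
        exact ⟨⟨s, h1⟩, fun h => h2 ⟨_, h, rfl⟩, rfl⟩
    change _ ∈ C
    rw [this]; exact hC.inter _ _ hD (hC.compl _ hP)
  · intro P R hP hR
    change _ ∈ C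
    rw [Set.image_inter Subtype.val_injective]
    exact hC.inter _ _ hP hR
  · intro P hP
    have : Subtype.val '' {s : D | ∃ s', jump next D s = some s' ∧ s' ∈ P} =
        D ∩ {s | ∃ s', next s = some s' ∧ s' ∈ {s | Unt next Dᶜ (Subtype.val '' P) s}} := by
      ext s; constructor
      · rintro ⟨s, ⟨s', h1, h2⟩, rfl⟩
        obtain ⟨t, h3, h4⟩ := jump_eq.1 h1
        refine ⟨s.2, t, h3, (unt_first (by simp)).2 ⟨s', ⟨s', h2, rfl⟩, h4⟩⟩
      · rintro ⟨h1, t, h2, h3⟩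
        obtain ⟨_, ⟨r, hr, rfl⟩, h4⟩ := (unt_first (by simp)).1 h3
        exact ⟨⟨s, h1⟩, ⟨r, jump_eq.2 ⟨t, h2, h4⟩, hr⟩, rfl⟩
    change _ ∈ C
    rw [this]
    exact hC.inter _ _ hD (hC.nxt _ (hC.unt _ _ (hC.compl _ hD) hP))
  · intro P R hP hR
    have : Subtype.val '' {s : D | Unt (jump next D) P R s} =
        D ∩ {s | Unt next (Subtype.val '' P ∪ Dᶜ) (Subtype.val '' R) s} := by
      ext s; constructor
      · rintro ⟨s, hs, rfl⟩
        refine ⟨s.2, ?_⟩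
        change Unt next (Subtype.val '' P ∪ Dᶜ) (Subtype.val '' R) s
        change Unt (jump next D) P R s at hs
        induction hs with
        | base h => exact .base ⟨_, h, rfl⟩
        | @step s s' h1 h2 _ ih =>
          obtain ⟨t, h3, h4⟩ := jump_eq.1 h2
          refine .step (Or.inl ⟨_, h1, rfl⟩) h3 ?_
          clear h2 h3
          generalize (s' : S) = r at h4 ih
          induction h4 with
          | here => exact ih
          | there h5 h6 _ ih2 => exact .step (Or.inr h5) h6 (ih2 ih)
      · rintro ⟨hs, h⟩
        change Unt next (Subtype.val '' P ∪ Dᶜ) (Subtype.val '' R) s at h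
        have key : (∃ r : D, First next D s r ∧ Unt (jump next D) P R r) := by
          clear hs
          induction h with
          | base h =>
            obtain ⟨r, hr, rfl⟩ := h
            exact ⟨r, .here r.2, .base hr⟩
          | @step s s' h1 h2 _ ih =>
            obtain ⟨r, h3, h4⟩ := ih
            rcases h1 with ⟨s, h1, rfl⟩ | h1
            · exact ⟨s, .here s.2, .step h1 (jump_eq.2 ⟨_, h2, h3⟩) h4⟩
            · exact ⟨r, .there h1 h2 h3, h4⟩
        obtain ⟨r, h1, h2⟩ := key
        have : s = r := (First.here hs).unique h1
        exact ⟨r, h2, this.symm⟩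
    change _ ∈ C
    rw [this]
    exact hC.inter _ _ hD (hC.unt _ _ (hC.union' hP (hC.compl _ hD)) hR)

/-- Block letters. -/
def Blk (next : S → Option S) (f1 : S → Option (Q → Q)) (D : Set S) (b : Q → Q) (s : D)
    (g' : Set.range b → Set.range b) : Prop :=
  ∃ t, next s = some t ∧ ∀ q : Set.range b, ∃ r, b r = (g' q).1 ∧ Reach next f1 D q r t

theorem Blk.unique {D : Set S} (hD : ∀ s ∈ D, f1 s = none) {b : Q → Q} {s : D}
    {g g' : Set.range b → Set.range b} (h : Blk next f1 D b s g) (h' : Blk next f1 D b s g') :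
    g = g' := by
  obtain ⟨t, h1, h2⟩ := h
  obtain ⟨t', h3, h4⟩ := h'
  rw [h1] at h3; cases h3
  funext q
  obtain ⟨r, e1, e2⟩ := h2 q
  obtain ⟨r', e3, e4⟩ := h4 q
  have := e2.unique hD e4
  subst this
  exact Subtype.ext (e1.symm.trans e3)

open Classical in
noncomputable def blkf (next : S → Option S) (f1 : S → Option (Q → Q)) (D : Set S) (b : Q → Q)
    (s : D) : Option (Set.range b → Set.range b) :=
  if h : ∃ g', Blk next f1 D b s g' then some h.choose else none

theorem blkf_eq {D : Set S} (hD : ∀ s ∈ D, f1 s = none) {b : Q → Q} {s : D}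
    {g : Set.range b → Set.range b} : blkf next f1 D b s = some g ↔ Blk next f1 D b s g := by
  unfold blkf
  split_ifs with h
  · constructor
    · intro e; cases e; exact h.choose_spec
    · intro h'; congr 1; exact h.choose_spec.unique hD h'
  · constructor
    · intro e; cases e
    · intro h'; exact absurd ⟨_, h'⟩ h

theorem reach_split {N : Set (Q → Q)} (hM : IsMon N)
    (hN : ∀ s g, f s = some g → g ∈ N) {b : Q → Q} {D : Set S}
    (hDb : ∀ s, s ∈ D ↔ f s = some b)
    (hf1 : ∀ s g, f1 s = some g ↔ f s = some g ∧ g ≠ b) {γ : Set S} {p q : Q} {s : S} :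
    Reach next f γ p q s ↔ Reach next f1 γ p q s ∨ ∃ (r0 : Q) (q1 : Set.range b),
      Reach next f1 (Subtype.val '' {s : D | Reach (jump next D) (blkf next f1 D b)
        {s : D | ∃ t, next s = some t ∧ Reach next f1 γ q1 q t} ⟨b r0, r0, rfl⟩ q1 s}) p r0 s := by
  have hD : ∀ s ∈ D, f1 s = none := by
    intro s hs
    cases h : f1 s with
    | none => rfl
    | some g =>
      have := (hf1 s g).1 h
      rw [(hDb s).1 hs] at this
      exact absurd (Option.some.inj this.1).symm this.2
  have hN1 : ∀ s g, f1 s = some g → g ∈ N := fun s g h => hN s g ((hf1 s g).1 h).1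
  have hmono : ∀ s g, f1 s = some g → f s = some g := fun s g h => ((hf1 s g).1 h).1
  constructor
  · intro h
    induction h with
    | base h => exact .inl (.base h)
    | @step p q s s' g h1 h2 _ ih =>
      by_cases hg : g = b
      · subst hg
        have hs : s ∈ D := (hDb s).2 h1
        right
        rcases ih with ih | ⟨r0, q1, ih⟩
        · refine ⟨p, ⟨g p, p, rfl⟩, .base ⟨⟨s, hs⟩, ?_, rfl⟩⟩
          exact .base ⟨s', h2, ih⟩
        · refine ⟨p, q1, .base ⟨⟨s, hs⟩, ?_, rfl⟩⟩
          obtain ⟨_, ⟨e, he, rfl⟩, u, hu, e1, e2, e3⟩ := ih.exists_end hM hN1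
          have hfi := e3 D hD e.2
          refine Reach.step (s' := e) (g := fun q => ⟨g (u q), _, rfl⟩) ?_
            (jump_eq.2 ⟨s', h2, hfi⟩) ?_
          · rw [blkf_eq hD]
            refine ⟨s', h2, fun q => ⟨u q, rfl, (e2 q).trans ?_⟩⟩
            rintro _ rfl
            exact .base e.2
          · have he' : Reach _ _ _ _ _ e := he
            simpa [e1] using he'
      · have h1' : f1 s = some g := (hf1 s g).2 ⟨h1, hg⟩
        rcases ih with ih | ⟨r0, q1, ih⟩
        · exact .inl (.step h1' h2 ih)
        · exact .inr ⟨r0, q1, .step h1' h2 ih⟩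
  · rintro (h | ⟨r0, q1, h⟩)
    · exact h.mono hmono
    · refine (h.mono hmono).trans ?_
      rintro _ ⟨s, hs, rfl⟩
      change Reach _ _ _ _ _ s at hs
      have key : ∀ (y : Set.range b) (q1' : Set.range b) (s : D), Reach (jump next D) (blkf next f1 D b)
          {s : D | ∃ t, next s = some t ∧ Reach next f1 γ q1 q t} y q1' s → q1' = q1 →
          ∀ r0, b r0 = y → Reach next f γ r0 q s := by
        intro y q1' s hs
        induction hs with
        | @base y s h =>
          rintro rfl r0 hr
          obtain ⟨t, h1, h2⟩ := h
          exact .step ((hDb s).1 s.2) h1 (by rw [hr]; exact h2.mono hmono)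
        | @step y y' s s'' g h1 h2 _ ih =>
          rintro rfl r0 hr
          rw [blkf_eq hD] at h1
          obtain ⟨t, h3, h4⟩ := h1
          obtain ⟨r, h5, h6⟩ := h4 y
          obtain ⟨t', h7, h8⟩ := jump_eq.1 h2
          rw [h3] at h7; cases h7
          obtain ⟨e, he, u, hu, e1, e2, e3⟩ := h6.exists_end hM hN1
          have : e = s'' := (e3 D hD he).unique h8
          subst this
          refine .step ((hDb s).1 s.2) h3 ?_
          rw [hr, ]
          have h9 := (e2 y).mono hmono
          rw [← e1] at h9
          refine h9.trans ?_
          rintro _ rfl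
          exact ih rfl r h5
      exact key _ _ s hs rfl r0 rfl

def Aper (N : Set (Q → Q)) : Prop :=
  ∀ g ∈ N, ∀ q : Q, ∃ k : ℕ, Nat.iterate g (k+1) q = Nat.iterate g k q

end

theorem kamp_id {S Q : Type} [Finite Q] {next : S → Option S} {C : Set (Set S)}
    (hC : TClosed next C) {f : S → Option (Q → Q)} (hf : ∀ g, {s | f s = some g} ∈ C)
    (hid : ∀ s g, f s = some g → g = id) {γ : Set S} (hγ : γ ∈ C) (p q : Q) :
    {s | Reach next f γ p q s} ∈ C := by
  have : {s | Reach next f γ p q s} = {_s | p = q} ∩ {s | Unt next {s | f s = some id} γ s} := by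
    ext s; constructor
    · intro h
      change Reach next f γ p q s at h
      induction h with
      | base h => exact ⟨rfl, .base h⟩
      | step h1 h2 _ ih =>
        have := hid _ _ h1
        subst this
        exact ⟨ih.1, Unt.step h1 h2 ih.2⟩
    · rintro ⟨h, h'⟩
      change p = q at h
      subst h
      change Unt _ _ _ s at h'
      change Reach next f γ p p s
      induction h' with
      | base h => exact .base h
      | step h1 h2 _ ih => exact .step h1 h2 ih
  rw [this]
  exact hC.inter _ _ (hC.const' _) (hC.unt _ _ (hf _) hγ)

theorem kamp_aux (n : ℕ) : ∀ (k : ℕ) (Q : Type) [Fintype Q], Fintype.card Q = n →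
    ∀ N : Set (Q → Q), IsMon N → Aper N →
    ∀ (S : Type) (next : S → Option S) (C : Set (Set S)), TClosed next C →
    ∀ f : S → Option (Q → Q), (∀ g, {s | f s = some g} ∈ C) → (∀ s g, f s = some g → g ∈ N) →
    ∀ B : Finset (Q → Q), B.card = k → (∀ s g, f s = some g → g ∈ B) →
    ∀ γ ∈ C, ∀ p q : Q, {s | Reach next f γ p q s} ∈ C := by
  classical
  induction n using Nat.strong_induction_on with
  | _ n IHn =>
  intro k
  induction k with
  | zero =>
    intro Q _ hQ N hM hap S next C hC f hf hN B hB hfB γ hγ p q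
    refine kamp_id hC hf ?_ hγ p q
    intro s g h
    have := hfB s g h
    rw [Finset.card_eq_zero] at hB
    simp [hB] at this
  | succ k IHk =>
    intro Q _ hQ N hM hap S next C hC f hf hN B hB hfB γ hγ p q
    by_cases hid : ∀ s g, f s = some g → g = id
    · exact kamp_id hC hf hid hγ p q
    push Not at hid
    obtain ⟨s0, b, hb, hbid⟩ := hid
    have hbN := hN _ _ hb
    have hsurj : ¬ Function.Surjective b := by
      intro hs
      have hinj : Function.Injective b := Finite.injective_iff_surjective.2 hs
      apply hbid
      funext x
      obtain ⟨k, hk⟩ := hap b hbN x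
      rw [Function.iterate_succ_apply] at hk
      exact (hinj.iterate k) hk
    have hcard : Fintype.card (Set.range b) < n := by
      rw [← hQ]
      refine Fintype.card_lt_of_injective_not_surjective Subtype.val Subtype.val_injective ?_
      intro h
      apply hsurj
      intro x
      obtain ⟨⟨_, y, rfl⟩, rfl⟩ := h x
      exact ⟨y, rfl⟩
    let D : Set S := {s | f s = some b}
    have hDC : D ∈ C := hf b
    let f1 : S → Option (Q → Q) := fun s => if f s = some b then none else f s
    have hf1 : ∀ s g, f1 s = some g ↔ f s = some g ∧ g ≠ b := by
      intro s g
      simp only [f1]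
      split_ifs with h
      · rw [h]; simp; exact fun h => h.symm
      · constructor
        · intro h'; refine ⟨h', ?_⟩; rintro rfl; exact h h'
        · exact fun h => h.1
    have hD1 : ∀ s ∈ D, f1 s = none := by
      intro s hs
      simp only [f1]
      exact if_pos hs
    have hN1 : ∀ s g, f1 s = some g → g ∈ N := fun s g h => hN s g ((hf1 s g).1 h).1
    have R1 : ∀ γ ∈ C, ∀ p q : Q, {s | Reach next f1 γ p q s} ∈ C := by
      refine IHk Q hQ N hM hap S next C hC f1 ?_ ?_ (B.erase b) ?_ ?_
      · intro g
        have : {s | f1 s = some g} = {s | f s = some g} ∩ {_s | g ≠ b} := by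
          ext s; exact hf1 s g
        rw [this]; exact hC.inter _ _ (hf g) (hC.const' _)
      · exact hN1
      · rw [Finset.card_erase_of_mem (hfB _ _ hb), hB]; rfl
      · intro s g h
        rw [hf1] at h
        exact Finset.mem_erase.2 ⟨h.2, hfB _ _ h.1⟩
    let N' : Set (Set.range b → Set.range b) := {g' | ∃ g ∈ N, ∀ q, (g' q).1 = g q.1}
    have hM' : IsMon N' := by
      refine ⟨⟨id, hM.one, fun _ => rfl⟩, ?_⟩
      rintro g1 g2 ⟨h1, hh1, e1⟩ ⟨h2, hh2, e2⟩
      refine ⟨h1 ∘ h2, hM.mul _ _ hh1 hh2, fun q => ?_⟩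
      change (g1 (g2 q)).1 = h1 (h2 q.1)
      rw [e1, e2]
    have hap' : Aper N' := by
      rintro g' ⟨g, hg, e⟩ q
      obtain ⟨k, hk⟩ := hap g hg q.1
      have : ∀ m, ((Nat.iterate g' m q : Set.range b) : Q) = Nat.iterate g m q.1 := by
        intro m
        induction m with
        | zero => rfl
        | succ m ih => rw [Function.iterate_succ_apply', Function.iterate_succ_apply', e, ih]
      refine ⟨k, Subtype.ext ?_⟩
      rw [this, this, hk]
    have R2 : ∀ Γ : Set D, Subtype.val '' Γ ∈ C → ∀ y y' : Set.range b,
        Subtype.val '' {s : D | Reach (jump next D) (blkf next f1 D b) Γ y y' s} ∈ C := by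
      refine IHn _ hcard _ (Set.range b) rfl N' hM' hap' D (jump next D) _
        (jump_closed hC hDC) (blkf next f1 D b) ?_ ?_ Finset.univ rfl (by simp)
      · intro g
        have : Subtype.val '' {s : D | blkf next f1 D b s = some g} =
            D ∩ {s | ∃ t, next s = some t ∧ t ∈ ⋂ q : Set.range b, ⋃ r : Q,
              {_t | b r = (g q).1} ∩ {t | Reach next f1 D q r t}} := by
          ext s; constructor
          · rintro ⟨s, hs, rfl⟩
            obtain ⟨t, h1, h2⟩ := (blkf_eq hD1).1 hs
            refine ⟨s.2, t, h1, ?_⟩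
            simp only [Set.mem_iInter, Set.mem_iUnion]
            exact h2
          · rintro ⟨hs, t, h1, h2⟩
            refine ⟨⟨s, hs⟩, (blkf_eq hD1).2 ⟨t, h1, ?_⟩, rfl⟩
            simp only [Set.mem_iInter, Set.mem_iUnion] at h2
            exact h2
        change _ ∈ C
        rw [this]
        exact hC.inter _ _ hDC (hC.nxt _ (hC.iInter' _ fun q => hC.iUnion' _ fun r =>
          hC.inter _ _ (hC.const' _) (R1 D hDC _ _)))
      · intro s g h
        obtain ⟨t, h1, h2⟩ := (blkf_eq hD1).1 h
        obtain ⟨r, h3, h4⟩ := h2 ⟨b p, p, rfl⟩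
        obtain ⟨e, he, u, hu, e1, e2, e3⟩ := h4.exists_end hM hN1
        refine ⟨_, hM.mul _ _ hbN hu, fun q => ?_⟩
        obtain ⟨r', h5, h6⟩ := h2 q
        have : Reach next f1 D q (u q) t := (e2 q).trans (by rintro _ rfl; exact .base he)
        have := h6.unique hD1 this
        rw [← h5, this]; rfl
    have : {s | Reach next f γ p q s} = {s | Reach next f1 γ p q s} ∪
        ⋃ r0 : Q, ⋃ q1 : Set.range b, {s | Reach next f1
          (Subtype.val '' {s : D | Reach (jump next D) (blkf next f1 D b)
          {s : D | ∃ t, next s = some t ∧ Reach next f1 γ q1 q t} ⟨b r0, r0, rfl⟩ q1 s}) p r0 s} := by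
      ext s
      simp only [Set.mem_union, Set.mem_iUnion]
      exact reach_split hM hN (fun s => Iff.rfl) hf1
    rw [this]
    refine hC.union' (R1 γ hγ p q) (hC.iUnion' _ fun r0 => hC.iUnion' _ fun q1 => ?_)
    refine R1 _ (R2 _ ?_ _ _) _ _
    have : Subtype.val '' {s : D | ∃ t, next s = some t ∧ Reach next f1 γ q1 q t} =
        D ∩ {s | ∃ t, next s = some t ∧ t ∈ {t | Reach next f1 γ q1 q t}} := by
      ext s; constructor
      · rintro ⟨s, hs, rfl⟩
        exact ⟨s.2, hs⟩
      · rintro ⟨h1, h2⟩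
        exact ⟨⟨s, h1⟩, h2, rfl⟩
    rw [this]
    exact hC.inter _ _ hDC (hC.nxt _ (R1 γ hγ _ _))

theorem kamp {Q : Type} [Finite Q] (N : Set (Q → Q)) (hM : IsMon N) (hN : Aper N)
    {S : Type} {next : S → Option S} {C : Set (Set S)} (hC : TClosed next C)
    (f : S → Option (Q → Q)) (hf : ∀ g, {s | f s = some g} ∈ C)
    (hfN : ∀ s g, f s = some g → g ∈ N) {γ : Set S} (hγ : γ ∈ C) (p q : Q) :
    {s | Reach next f γ p q s} ∈ C := by
  classical
  have := Fintype.ofFinite Q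
  exact kamp_aux _ _ Q rfl N hM hN S next C hC f hf hfN Finset.univ rfl (by simp) γ hγ p q
end Kamp

section Ltl
/-! ## One-step unfolding of path formulas, and aperiodicity -/

/-- One step of backward evaluation: `a` gives the truth values of state formulas at the
current position, `v` the truth values of all path formulas at the next one. -/
def stp {Y : Type} (a v : CPath Y → Prop) : CPath Y → Prop
  | .st φ => a (.st φ)
  | .not χ => ¬ stp a v χ
  | .and χ χ' => stp a v χ ∧ stp a v χ'
  | .X χ => v χ
  | .U χ χ' => stp a v χ' ∨ (stp a v χ ∧ v (.U χ χ'))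

/-- Path subformulas. -/
def psub {Y : Type} : CPath Y → Set (CPath Y)
  | .st φ => {.st φ}
  | .not χ => insert (.not χ) (psub χ)
  | .and χ χ' => insert (.and χ χ') (psub χ ∪ psub χ')
  | .X χ => insert (.X χ) (psub χ)
  | .U χ χ' => insert (.U χ χ') (psub χ ∪ psub χ')

theorem psub_self {Y : Type} (ψ : CPath Y) : ψ ∈ psub ψ := by
  cases ψ <;> simp [psub]

theorem psub_finite {Y : Type} : ∀ ψ : CPath Y, (psub ψ).Finite
  | .st φ => by simp [psub]
  | .not χ => by simpa [psub] using psub_finite χ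
  | .and χ χ' => by simpa [psub] using ⟨psub_finite χ, psub_finite χ'⟩
  | .X χ => by simpa [psub] using psub_finite χ
  | .U χ χ' => by simpa [psub] using ⟨psub_finite χ, psub_finite χ'⟩

theorem psub_trans {Y : Type} : ∀ ψ χ : CPath Y, χ ∈ psub ψ → psub χ ⊆ psub ψ
  | .st φ, χ, h => by simp [psub] at h; subst h; rfl
  | .not ψ, χ, h => by
    rcases h with rfl | h
    · rfl
    · exact (psub_trans ψ χ h).trans (Set.subset_insert _ _)
  | .and ψ ψ', χ, h => by
    rcases h with rfl | h | h
    · rfl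
    · exact ((psub_trans ψ χ h).trans Set.subset_union_left).trans (Set.subset_insert _ _)
    · exact ((psub_trans ψ' χ h).trans Set.subset_union_right).trans (Set.subset_insert _ _)
  | .X ψ, χ, h => by
    rcases h with rfl | h
    · rfl
    · exact (psub_trans ψ χ h).trans (Set.subset_insert _ _)
  | .U ψ ψ', χ, h => by
    rcases h with rfl | h | h
    · rfl
    · exact ((psub_trans ψ χ h).trans Set.subset_union_left).trans (Set.subset_insert _ _)
    · exact ((psub_trans ψ' χ h).trans Set.subset_union_right).trans (Set.subset_insert _ _)

theorem stp_congr {Y : Type} {a a' v v' : CPath Y → Prop} : ∀ χ : CPath Y,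
    (∀ ξ ∈ psub χ, (a ξ ↔ a' ξ) ∧ (v ξ ↔ v' ξ)) → (stp a v χ ↔ stp a' v' χ)
  | .st _, h => (h _ (psub_self _)).1
  | .not χ, h => not_congr (stp_congr χ fun ξ hξ => h ξ (.inr hξ))
  | .and χ χ', h => and_congr (stp_congr χ fun ξ hξ => h ξ (.inr (.inl hξ)))
      (stp_congr χ' fun ξ hξ => h ξ (.inr (.inr hξ)))
  | .X χ, h => (h χ (.inr (psub_self _))).2
  | .U χ χ', h => or_congr (stp_congr χ' fun ξ hξ => h ξ (.inr (.inr hξ)))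
      (and_congr (stp_congr χ fun ξ hξ => h ξ (.inr (.inl hξ))) (h _ (psub_self _)).2)

theorem stp_periodic {Y : Type} (a w : ℕ → CPath Y → Prop) (m : ℕ)
    (ha : ∀ n, a (n + m) = a n) (hw : ∀ n, w (n + 1) = stp (a n) (w n)) :
    ∀ χ : CPath Y, ∃ N, ∀ n, N ≤ n → (w (n + m) χ ↔ w n χ)
  | .st φ => ⟨1, fun n hn => by
      obtain ⟨n, rfl⟩ := Nat.exists_eq_add_of_le' hn
      rw [show n + 1 + m = n + m + 1 by ring, hw, hw, ha]; rfl⟩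
  | .not χ => by
    obtain ⟨N, hN⟩ := stp_periodic a w m ha hw χ
    refine ⟨N + 1, fun n hn => ?_⟩
    obtain ⟨n, rfl⟩ := Nat.exists_eq_add_of_le' (show 1 ≤ n by omega)
    have h1 := hN (n + 1) (by omega)
    rw [show n + 1 + m = n + m + 1 by ring, hw, hw] at h1 ⊢
    exact not_congr h1
  | .and χ χ' => by
    obtain ⟨N, hN⟩ := stp_periodic a w m ha hw χ
    obtain ⟨N', hN'⟩ := stp_periodic a w m ha hw χ'
    refine ⟨N + N' + 1, fun n hn => ?_⟩
    obtain ⟨n, rfl⟩ := Nat.exists_eq_add_of_le' (show 1 ≤ n by omega)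
    have h1 := hN (n + 1) (by omega)
    have h2 := hN' (n + 1) (by omega)
    rw [show n + 1 + m = n + m + 1 by ring, hw, hw] at h1 h2 ⊢
    exact and_congr h1 h2
  | .X χ => by
    obtain ⟨N, hN⟩ := stp_periodic a w m ha hw χ
    refine ⟨N + 1, fun n hn => ?_⟩
    obtain ⟨n, rfl⟩ := Nat.exists_eq_add_of_le' (show 1 ≤ n by omega)
    have h1 := hN n (by omega)
    rw [show n + 1 + m = n + m + 1 by ring, hw, hw]
    exact h1
  | .U χ χ' => by
    obtain ⟨N, hN⟩ := stp_periodic a w m ha hw χ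
    obtain ⟨N', hN'⟩ := stp_periodic a w m ha hw χ'
    have hU : ∀ n, w (n + 1) (.U χ χ') ↔
        (w (n + 1) χ' ∨ (w (n + 1) χ ∧ w n (.U χ χ'))) := by
      intro n
      simp only [hw n]
      rfl
    have hp : ∀ n, N + N' ≤ n → (w (n + 1 + m) χ ↔ w (n + 1) χ) ∧ (w (n + 1 + m) χ' ↔ w (n + 1) χ') :=
      fun n hn => ⟨hN _ (by omega), hN' _ (by omega)⟩
    have hU2 : ∀ n, N + N' ≤ n → (w (n + 1 + m) (.U χ χ') ↔
        (w (n + 1) χ' ∨ (w (n + 1) χ ∧ w (n + m) (.U χ χ')))) := by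
      intro n hn
      rw [← (hp n hn).1, ← (hp n hn).2, show n + 1 + m = n + m + 1 by ring]
      exact hU _
    by_cases hc : ∃ j, N + N' ≤ j ∧ (w (j + m) (.U χ χ') ↔ w j (.U χ χ'))
    · obtain ⟨j, hj, hj'⟩ := hc
      refine ⟨j, fun n hn => ?_⟩
      induction n, hn using Nat.le_induction with
      | base => exact hj'
      | succ n hn ih => rw [hU2 n (by omega), hU n, ih]
    · push Not at hc
      exfalso
      have hconst : ∀ j, w (N + N' + j) (.U χ χ') ↔ w (N + N') (.U χ χ') := by
        intro j
        induction j with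
        | zero => rfl
        | succ j ih =>
          have h1 := hc (N + N' + j + 1) (by omega)
          rw [← add_assoc]
          rw [hU2 (N + N' + j) (by omega), hU (N + N' + j)] at h1
          rw [hU]
          tauto
      have h1 := hc (N + N') le_rfl
      have h2 := hconst m
      tauto

/-- valuations of a set of path formulas -/
abbrev Vl {Y : Type} (F : Set (CPath Y)) : Type := F → Prop

def Vl.ext {Y : Type} {F : Set (CPath Y)} (v : Vl F) : CPath Y → Prop := fun χ => ∃ h : χ ∈ F, v ⟨χ, h⟩

def stpF {Y : Type} (F : Set (CPath Y)) (a v : Vl F) : Vl F := fun χ => stp a.ext v.ext χ.1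

def rs {Y : Type} (F : Set (CPath Y)) (w : CPath Y → Prop) : Vl F := fun χ => w χ.1

theorem rs_ext {Y : Type} {F : Set (CPath Y)} (v : Vl F) : rs F v.ext = v := by
  funext χ
  simp [rs, Vl.ext]

theorem stpF_rs {Y : Type} (ψ : CPath Y) (a w : CPath Y → Prop) :
    stpF (psub ψ) (rs _ a) (rs _ w) = rs _ (stp a w) := by
  funext χ
  apply propext
  apply stp_congr
  intro ξ hξ
  have := psub_trans ψ χ.1 χ.2 hξ
  simp [Vl.ext, rs, this]

/-- composites of steps -/
inductive Cmp {Y : Type} (F : Set (CPath Y)) : (Vl F → Vl F) → Prop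
  | one : Cmp F id
  | mul (a : Vl F) {g} : Cmp F g → Cmp F (stpF F a ∘ g)

theorem Cmp.comp {Y : Type} {F : Set (CPath Y)} {g h : Vl F → Vl F} (hg : Cmp F g) (hh : Cmp F h) :
    Cmp F (g ∘ h) := by
  induction hg with
  | one => exact hh
  | mul a _ ih => exact .mul a ih

theorem Cmp.word {Y : Type} {F : Set (CPath Y)} {g : Vl F → Vl F} (hg : Cmp F g) :
    ∃ (m : ℕ) (a : ℕ → Vl F), ∀ w : ℕ → Vl F, (∀ n, n < m → w (n + 1) = stpF F (a n) (w n)) →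
      w m = g (w 0) := by
  induction hg with
  | one => exact ⟨0, fun _ _ => False, fun w _ => rfl⟩
  | mul b _ ih =>
    obtain ⟨m, a, h⟩ := ih
    refine ⟨m + 1, fun n => if n = m then b else a n, fun w hw => ?_⟩
    rw [hw m (by omega), h w (fun n hn => by rw [hw n (by omega)]; simp [hn.ne])]
    simp

theorem Cmp.aper {Y : Type} {ψ : CPath Y} {g : Vl (psub ψ) → Vl (psub ψ)} (hg : Cmp (psub ψ) g)
    (v : Vl (psub ψ)) : ∃ K, ∀ k, K ≤ k → g^[k + 1] v = g^[k] v := by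
  obtain ⟨m, a, h⟩ := hg.word
  rcases Nat.eq_zero_or_pos m with rfl | hm
  · have : g = id := by
      funext v
      have := h (fun _ => v) (by simp)
      exact this.symm
    subst this
    exact ⟨0, fun k _ => by simp⟩
  let w : ℕ → CPath Y → Prop := fun n => Nat.rec v.ext (fun n w => stp (a (n % m)).ext w) n
  have hw : ∀ n, w (n + 1) = stp (a (n % m)).ext (w n) := fun n => rfl
  have hw' : ∀ n, rs (psub ψ) (w (n + 1)) = stpF _ (a (n % m)) (rs _ (w n)) := by
    intro n
    rw [hw, ← stpF_rs, rs_ext]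
  have hit : ∀ k, rs (psub ψ) (w (m * k)) = g^[k] v := by
    intro k
    induction k with
    | zero => exact rs_ext v
    | succ k ih =>
      rw [Function.iterate_succ_apply', ← ih]
      have := h (fun n => rs _ (w (m * k + n))) (by
        intro n hn
        change rs _ (w (m * k + n + 1)) = _
        rw [hw']
        simp [Nat.add_mod, Nat.mod_eq_of_lt hn])
      exact this
  have hper := stp_periodic (fun n => (a (n % m)).ext) w m (by intro n; simp) hw
  choose N hN using hper
  have hfin := psub_finite ψ
  obtain ⟨K, hK⟩ : ∃ K, ∀ χ ∈ psub ψ, N χ ≤ K := by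
    obtain ⟨K, hK⟩ := (hfin.image N).bddAbove
    exact ⟨K, fun χ hχ => hK ⟨χ, hχ, rfl⟩⟩
  refine ⟨K, fun k hk => ?_⟩
  rw [← hit, ← hit]
  funext χ
  apply propext
  refine hN χ.1 (m * k) ?_
  calc N χ.1 ≤ K := hK _ χ.2
    _ ≤ k := hk
    _ ≤ m * k := Nat.le_mul_of_pos_left k hm

theorem finite_Vl {Y : Type} (ψ : CPath Y) : Finite (Vl (psub ψ)) := by
  have := (psub_finite ψ).to_subtype
  infer_instance

/-- The monoid of preimage maps. -/
def preM {Y : Type} (F : Set (CPath Y)) : Set (Set (Vl F) → Set (Vl F)) :=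
  {h | ∃ g, Cmp F g ∧ h = Set.preimage g}

theorem preM_mon {Y : Type} (F : Set (CPath Y)) : IsMon (preM F) := by
  refine ⟨⟨id, .one, rfl⟩, ?_⟩
  rintro _ _ ⟨g, hg, rfl⟩ ⟨h, hh, rfl⟩
  exact ⟨h ∘ g, hh.comp hg, rfl⟩

theorem preM_aper {Y : Type} (ψ : CPath Y) : Aper (preM (psub ψ)) := by
  rintro _ ⟨g, hg, rfl⟩ Φ
  have hf := finite_Vl ψ
  have h := fun v => hg.aper v
  choose K hK using h
  obtain ⟨k, hk⟩ := (Set.finite_range K).bddAbove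
  have e : g^[k + 1] = g^[k] := funext fun v => hK v k (hk ⟨v, rfl⟩)
  refine ⟨k, ?_⟩
  rw [← Set.preimage_iterate_eq, ← Set.preimage_iterate_eq, e]
end Ltl

section Paths
/-! ## Paths as words and as sets -/

def nds (π : PathW) : Set Node := {τ | ∃ i : ℕ, (i : ℕ∞) < π.len ∧ π.seq i = τ}

theorem lt_of_le_lt {i j : ℕ} {l : ℕ∞} (h : i ≤ j) (h' : (j : ℕ∞) < l) : (i : ℕ∞) < l :=
  lt_of_le_of_lt (by exact_mod_cast h) h'

namespace ValidPath
variable {T : Set Node} {π : PathW}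

theorem length_seq (hv : ValidPath T π) : ∀ i : ℕ, (i : ℕ∞) < π.len →
    (π.seq i).length = (π.seq 0).length + i := by
  intro i
  induction i with
  | zero => simp
  | succ i ih =>
    intro h
    obtain ⟨n, hn⟩ := hv.2.2 i h
    rw [hn, List.length_append, ih (lt_of_le_lt (Nat.le_succ i) h)]
    simp; ring

theorem prefix_seq (hv : ValidPath T π) {i j : ℕ} (hij : i ≤ j) (hj : (j : ℕ∞) < π.len) :
    π.seq i <+: π.seq j := by
  induction j, hij using Nat.le_induction with
  | base => exact List.prefix_rfl
  | succ j _ ih =>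
    obtain ⟨n, hn⟩ := hv.2.2 j hj
    rw [hn]
    exact (ih (lt_of_le_lt (Nat.le_succ j) hj)).trans (List.prefix_append _ _)

theorem seq_inj (hv : ValidPath T π) {i j : ℕ} (hi : (i : ℕ∞) < π.len) (hj : (j : ℕ∞) < π.len)
    (h : π.seq i = π.seq j) : i = j := by
  have h1 := hv.length_seq i hi
  have h2 := hv.length_seq j hj
  rw [h] at h1; omega

theorem zero_mem (hv : ValidPath T π) : π.seq 0 ∈ nds π := ⟨0, hv.1, rfl⟩

/-- a node above the start, below a node of the path, is on the path -/
theorem mem_of_prefix (hv : ValidPath T π) {τ σ : Node} (hσ : σ ∈ nds π) (h0 : π.seq 0 <+: τ)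
    (h : τ <+: σ) : τ ∈ nds π := by
  obtain ⟨j, hj, rfl⟩ := hσ
  have h1 := h0.length_le
  have h2 := h.length_le
  have h3 := hv.length_seq j hj
  have hi : τ.length - (π.seq 0).length ≤ j := by omega
  have h4 := hv.length_seq _ (lt_of_le_lt hi hj)
  refine ⟨_, lt_of_le_lt hi hj, ?_⟩
  have h5 := hv.prefix_seq hi hj
  exact (List.prefix_of_prefix_length_le h5 h (by omega)).eq_of_length (by omega)

theorem zero_prefix (hv : ValidPath T π) {τ : Node} (h : τ ∈ nds π) : π.seq 0 <+: τ := by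
  obtain ⟨j, hj, rfl⟩ := h
  exact hv.prefix_seq (Nat.zero_le j) hj

theorem rooted (hv : ValidPath T π) : IsTreeRooted (nds π) (π.seq 0) := by
  refine ⟨hv.zero_mem, fun τ h => hv.zero_prefix h, fun σ σ' h h' => ?_⟩
  exact hv.mem_of_prefix h (List.prefix_append _ _) ((List.prefix_append_right_inj _).2 h')

theorem sub (hv : ValidPath T π) : nds π ⊆ T := by
  rintro _ ⟨j, hj, rfl⟩
  exact hv.2.1 j hj

theorem chain (hv : ValidPath T π) {τ σ : Node} (h : τ ∈ nds π) (h' : σ ∈ nds π) :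
    τ <+: σ ∨ σ <+: τ := by
  obtain ⟨i, hi, rfl⟩ := h
  obtain ⟨j, hj, rfl⟩ := h'
  rcases le_total i j with h | h
  · exact .inl (hv.prefix_seq h hj)
  · exact .inr (hv.prefix_seq h hi)

theorem eq_of_len (hv : ValidPath T π) {τ σ : Node} (h : τ ∈ nds π) (h' : σ ∈ nds π)
    (e : τ.length = σ.length) : τ = σ := by
  rcases hv.chain h h' with h | h
  · exact h.eq_of_length e
  · exact (h.eq_of_length e.symm).symm

theorem isPathOf (hv : ValidPath T π) : IsPathOf T (nds π) := by
  refine ⟨⟨hv.sub, _, hv.rooted⟩, fun τ _ n m h h' => ?_⟩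
  have := hv.eq_of_len h h' (by simp)
  simpa using this

theorem finite_iff (hv : ValidPath T π) : (nds π).Finite ↔ π.len ≠ ⊤ := by
  have e : nds π = π.seq '' {i : ℕ | (i : ℕ∞) < π.len} := by
    ext τ; rfl
  have hinj : Set.InjOn π.seq {i : ℕ | (i : ℕ∞) < π.len} := fun i hi j hj h => hv.seq_inj hi hj h
  rw [e, Set.finite_image_iff hinj]
  constructor
  · intro h h'
    rw [h'] at h
    simp only [ENat.natCast_lt_top, Set.ofPred_true] at h
    exact Set.infinite_univ h
  · intro h
    obtain ⟨n, hn⟩ := ENat.ne_top_iff_exists.1 h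
    rw [← hn]
    simp only [Nat.cast_lt]
    exact Set.finite_lt_nat n

end ValidPath

theorem exists_path_of_set {T S : Set Node} (h : IsPathOf T S) :
    ∃ π, ValidPath T π ∧ nds π = S := by
  classical
  obtain ⟨⟨hT, r, hr, hpre, hcl⟩, huniq⟩ := h
  have hdown : ∀ τ n, r <+: τ → τ ++ [n] ∈ S → τ ∈ S := by
    rintro _ n ⟨σ, rfl⟩ h
    rw [List.append_assoc] at h
    exact hcl _ _ h (List.prefix_append _ _)
  have hsplit : ∀ i τ, τ ∈ S → τ.length = r.length + (i + 1) → ∃ σ n, τ = σ ++ [n] ∧ σ ∈ S ∧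
      σ.length = r.length + i := by
    intro i τ hτ hl
    rcases List.eq_nil_or_concat τ with rfl | ⟨σ, n, rfl⟩
    · simp at hl
    · rw [List.concat_eq_append] at hτ hl ⊢
      have h1 : σ.length = r.length + i := by simp at hl; omega
      have h2 := hpre _ hτ
      have : r <+: σ := List.prefix_of_prefix_length_le h2 (List.prefix_append _ _) (by omega)
      exact ⟨σ, n, rfl, hdown σ n this hτ, h1⟩
  have hun : ∀ i τ τ', τ ∈ S → τ' ∈ S → τ.length = r.length + i → τ'.length = r.length + i →
      τ = τ' := by
    intro i
    induction i with
    | zero =>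
      intro τ τ' h h' e e'
      rw [← (hpre _ h).eq_of_length (by omega), ← (hpre _ h').eq_of_length (by omega)]
    | succ i ih =>
      intro τ τ' h h' e e'
      obtain ⟨σ, n, rfl, h1, h2⟩ := hsplit i _ h e
      obtain ⟨σ', n', rfl, h1', h2'⟩ := hsplit i _ h' e'
      have := ih _ _ h1 h1' h2 h2'
      subst this
      rw [huniq σ h1 n n' h h']
  let G : ℕ → Prop := fun i => ∃ τ ∈ S, τ.length = r.length + i
  have hG : ∀ i j, i ≤ j → G j → G i := by
    intro i j hij
    induction j, hij using Nat.le_induction with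
    | base => exact id
    | succ j _ ih =>
      rintro ⟨τ, h1, h2⟩
      obtain ⟨σ, n, _, h3, h4⟩ := hsplit j τ h1 h2
      exact ih ⟨σ, h3, h4⟩
  obtain ⟨l, hl⟩ : ∃ l : ℕ∞, ∀ i : ℕ, (i : ℕ∞) < l ↔ G i := by
    by_cases hall : ∀ i, G i
    · exact ⟨⊤, fun i => by simp [hall i]⟩
    · push Not at hall
      refine ⟨(Nat.find hall : ℕ), fun i => ?_⟩
      rw [Nat.cast_lt, Nat.lt_find_iff]
      constructor
      · intro h; simpa using h i le_rfl
      · intro h m hm h'; exact h' (hG m i hm h)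
  let sq : ℕ → Node := fun i => if h : G i then h.choose else r
  have hsq : ∀ i, G i → sq i ∈ S ∧ (sq i).length = r.length + i := by
    intro i h
    simp only [sq, dif_pos h]
    exact h.choose_spec
  refine ⟨⟨l, sq⟩, ⟨?_, ?_, ?_⟩, ?_⟩
  · have := (hl 0).2 ⟨r, hr, rfl⟩
    exact_mod_cast this
  · intro i hi
    exact hT (hsq i ((hl i).1 hi)).1
  · intro i hi
    obtain ⟨h1, h2⟩ := hsq _ ((hl _).1 hi)
    obtain ⟨σ, n, h3, h4, h5⟩ := hsplit i _ h1 h2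
    obtain ⟨h6, h7⟩ := hsq i (hG i (i+1) (by omega) ((hl _).1 hi))
    refine ⟨n, ?_⟩
    change sq (i + 1) = sq i ++ [n]
    rw [h3, hun i _ _ h4 h6 h5 h7]
  · ext τ
    constructor
    · rintro ⟨i, hi, rfl⟩
      exact (hsq i ((hl i).1 hi)).1
    · intro h
      have h1 := (hpre τ h).length_le
      have h2 : τ.length = r.length + (τ.length - r.length) := by omega
      have h3 : G (τ.length - r.length) := ⟨τ, h, h2⟩
      refine ⟨_, (hl _).2 h3, ?_⟩
      exact hun _ _ _ (hsq _ h3).1 h (hsq _ h3).2 h2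

/-- prepend a node -/
def pcons (τ : Node) (π : PathW) : PathW :=
  ⟨π.len + 1, fun i => match i with | 0 => τ | i + 1 => π.seq i⟩

/-- drop the first `n` nodes -/
def ptl (n : ℕ) (π : PathW) : PathW := ⟨π.len - n, fun i => π.seq (i + n)⟩

def psing (τ : Node) : PathW := ⟨1, fun _ => τ⟩

theorem pcons_lt {τ : Node} {π : PathW} {i : ℕ} :
    ((i + 1 : ℕ) : ℕ∞) < (pcons τ π).len ↔ (i : ℕ∞) < π.len := by
  simp only [pcons]
  push_cast
  exact ENat.add_lt_add_iff_right (by simp)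

theorem ptl_lt {n : ℕ} {π : PathW} {i : ℕ} :
    (i : ℕ∞) < (ptl n π).len ↔ ((i + n : ℕ) : ℕ∞) < π.len := by
  simp only [ptl]
  rw [lt_tsub_iff_right]
  push_cast
  rfl

theorem pcons_valid {T : Set Node} {τ : Node} {π : PathW} (hv : ValidPath T π) (hτ : τ ∈ T)
    (hc : ∃ n : ℕ, π.seq 0 = τ ++ [n]) : ValidPath T (pcons τ π) := by
  refine ⟨by simp [pcons], ?_, ?_⟩
  · rintro (_ | i) h
    · exact hτ
    · exact hv.2.1 i (pcons_lt.1 h)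
  · rintro (_ | i) h
    · exact hc
    · exact hv.2.2 i (pcons_lt.1 h)

theorem ptl_valid {T : Set Node} {n : ℕ} {π : PathW} (hv : ValidPath T π) (hn : (n : ℕ∞) < π.len) :
    ValidPath T (ptl n π) := by
  refine ⟨?_, ?_, ?_⟩
  · have := (ptl_lt (n := n) (π := π) (i := 0)).2 (by simpa using hn)
    exact_mod_cast this
  · intro i h
    exact hv.2.1 _ (ptl_lt.1 h)
  · intro i h
    have := hv.2.2 (i + n) (by rw [ptl_lt] at h; convert h using 2; ring)
    simp only [ptl]
    convert this using 4
    ring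

theorem psing_valid {T : Set Node} {τ : Node} (h : τ ∈ T) : ValidPath T (psing τ) := by
  refine ⟨by simp [psing], fun i _ => h, ?_⟩
  intro i h'
  simp only [psing] at h'
  have : i + 1 < 1 := by exact_mod_cast h'
  omega

theorem nds_psing (τ : Node) : nds (psing τ) = {τ} := by
  ext σ
  constructor
  · rintro ⟨i, _, rfl⟩; rfl
  · rintro rfl; exact ⟨0, by simp [psing], rfl⟩

theorem nds_pcons (τ : Node) (π : PathW) : nds (pcons τ π) = insert τ (nds π) := by
  ext σ
  constructor
  · rintro ⟨_ | i, h, rfl⟩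
    · exact .inl rfl
    · exact .inr ⟨i, pcons_lt.1 h, rfl⟩
  · rintro (rfl | ⟨i, h, rfl⟩)
    · exact ⟨0, by simp [pcons], rfl⟩
    · exact ⟨i + 1, pcons_lt.2 h, rfl⟩

theorem nds_ptl {T : Set Node} {n : ℕ} {π : PathW} (hv : ValidPath T π) (hn : (n : ℕ∞) < π.len) :
    nds (ptl n π) = {σ ∈ nds π | π.seq n <+: σ} := by
  ext σ
  constructor
  · rintro ⟨i, h, rfl⟩
    rw [ptl_lt] at h
    exact ⟨⟨_, h, rfl⟩, hv.prefix_seq (by omega) h⟩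
  · rintro ⟨⟨j, hj, rfl⟩, h⟩
    have h1 := h.length_le
    rw [hv.length_seq n hn, hv.length_seq j hj] at h1
    have e : j - n + n = j := by omega
    refine ⟨j - n, ptl_lt.2 ?_, ?_⟩
    · rwa [e]
    · simp [ptl, e]
end Paths

section Hat1
/-! ## Pointed paths and definable sets of them -/

structure PROK (PR : ℕ∞ → Prop) : Prop where
  succ : ∀ l, PR (l + 1) ↔ PR l
  one : PR 1

theorem PROK.sub {PR : ℕ∞ → Prop} (h : PROK PR) {l : ℕ∞} {n : ℕ} (hn : (n : ℕ∞) < l) :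
    PR (l - n) ↔ PR l := by
  have : ∀ (n : ℕ) (m : ℕ∞), PR (m + n) ↔ PR m := by
    intro n
    induction n with
    | zero => simp
    | succ n ih =>
      intro m
      push_cast
      rw [← add_assoc, h.succ, ih]
  rw [← this n (l - n), tsub_add_cancel_of_le hn.le]

section
variable {Y : Type} {PR : ℕ∞ → Prop} {K : KripkeTree Y}

theorem cpsat_shift {π π' : PathW} {c : ℕ}
    (hl : ∀ k : ℕ, (k : ℕ∞) < π.len ↔ ((k + c : ℕ) : ℕ∞) < π'.len)
    (hs : ∀ k : ℕ, (k : ℕ∞) < π.len → π.seq k = π'.seq (k + c)) :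
    ∀ (χ : CPath Y) (k : ℕ), (k : ℕ∞) < π.len → (cpsat PR K χ π k ↔ cpsat PR K χ π' (k + c))
  | .st φ, k, hk => by simp only [cpsat]; rw [hs k hk]
  | .not χ, k, hk => by simp only [cpsat]; rw [cpsat_shift hl hs χ k hk]
  | .and χ χ', k, hk => by
    simp only [cpsat]; rw [cpsat_shift hl hs χ k hk, cpsat_shift hl hs χ' k hk]
  | .X χ, k, hk => by
    simp only [cpsat]
    rw [hl (k + 1), show k + 1 + c = k + c + 1 by ring]
    refine and_congr_right fun h => ?_
    rw [cpsat_shift hl hs χ (k + 1) (by rw [hl, show k + 1 + c = k + c + 1 by ring]; exact h),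
      show k + 1 + c = k + c + 1 by ring]
  | .U χ χ', k, hk => by
    simp only [cpsat]
    constructor
    · rintro ⟨j, h1, h2, h3, h4⟩
      refine ⟨j + c, by omega, (hl j).1 h2, (cpsat_shift hl hs χ' j h2).1 h3, fun i hi hi' => ?_⟩
      obtain ⟨i, rfl⟩ : ∃ i', i = i' + c := ⟨i - c, by omega⟩
      exact (cpsat_shift hl hs χ i (lt_of_le_lt (by omega) h2)).1 (h4 i (by omega) (by omega))
    · rintro ⟨j, h1, h2, h3, h4⟩
      obtain ⟨j, rfl⟩ : ∃ j', j = j' + c := ⟨j - c, by omega⟩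
      have h2' := (hl j).2 h2
      refine ⟨j, by omega, h2', (cpsat_shift hl hs χ' j h2').2 h3, fun i hi hi' => ?_⟩
      exact (cpsat_shift hl hs χ i (lt_of_le_lt (by omega) h2')).2 (h4 (i + c) (by omega) (by omega))

theorem cpsat_pcons {τ : Node} {π : PathW} (χ : CPath Y) {k : ℕ} (hk : (k : ℕ∞) < π.len) :
    cpsat PR K χ (pcons τ π) (k + 1) ↔ cpsat PR K χ π k :=
  (cpsat_shift (fun _ => pcons_lt.symm) (fun _ _ => rfl) χ k hk).symm

theorem cpsat_ptl {n : ℕ} {π : PathW} (χ : CPath Y) {k : ℕ} (hk : ((k + n : ℕ) : ℕ∞) < π.len) :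
    cpsat PR K χ (ptl n π) k ↔ cpsat PR K χ π (k + n) :=
  cpsat_shift (fun _ => ptl_lt) (fun _ _ => rfl) χ k (ptl_lt.2 hk)

theorem cpsat_U_unfold {χ χ' : CPath Y} {π : PathW} {i : ℕ} (hi : (i : ℕ∞) < π.len) :
    cpsat PR K (.U χ χ') π i ↔ cpsat PR K χ' π i ∨
      (cpsat PR K χ π i ∧ ((i + 1 : ℕ) : ℕ∞) < π.len ∧ cpsat PR K (.U χ χ') π (i + 1)) := by
  simp only [cpsat]
  constructor
  · rintro ⟨j, h1, h2, h3, h4⟩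
    rcases Nat.eq_or_lt_of_le h1 with rfl | h
    · exact .inl h3
    · exact .inr ⟨h4 i le_rfl h, lt_of_le_lt h h2, j, h, h2, h3, fun k hk hk' => h4 k (by omega) hk'⟩
  · rintro (h | ⟨h, _, j, h1, h2, h3, h4⟩)
    · exact ⟨i, le_rfl, hi, h, fun k hk hk' => by omega⟩
    · refine ⟨j, by omega, h2, h3, fun k hk hk' => ?_⟩
      rcases Nat.eq_or_lt_of_le hk with rfl | hk
      · exact h
      · exact h4 k hk hk'

theorem cpsat_stp {π : PathW} {i : ℕ} (hi : ((i + 1 : ℕ) : ℕ∞) < π.len) : ∀ χ : CPath Y,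
    cpsat PR K χ π i ↔ stp (fun ξ => cpsat PR K ξ π i) (fun ξ => cpsat PR K ξ π (i + 1)) χ
  | .st φ => Iff.rfl
  | .not χ => by simp only [cpsat, stp]; rw [cpsat_stp hi χ]
  | .and χ χ' => by simp only [cpsat, stp]; rw [cpsat_stp hi χ, cpsat_stp hi χ']
  | .X χ => by simp only [cpsat, stp]; tauto
  | .U χ χ' => by
    rw [cpsat_U_unfold (lt_of_le_lt (Nat.le_succ i) hi)]
    simp only [stp]; rw [cpsat_stp hi χ, cpsat_stp hi χ']
    tauto

theorem cpsat_stp_end {π : PathW} {i : ℕ} (h0 : (i : ℕ∞) < π.len)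
    (hi : ¬ ((i + 1 : ℕ) : ℕ∞) < π.len) : ∀ χ : CPath Y,
    cpsat PR K χ π i ↔ stp (fun ξ => cpsat PR K ξ π i) (fun _ => False) χ
  | .st φ => Iff.rfl
  | .not χ => by simp only [cpsat, stp]; rw [cpsat_stp_end h0 hi χ]
  | .and χ χ' => by simp only [cpsat, stp]; rw [cpsat_stp_end h0 hi χ, cpsat_stp_end h0 hi χ']
  | .X χ => by simp only [cpsat, stp]; tauto
  | .U χ χ' => by
    rw [cpsat_U_unfold h0]
    simp only [stp]; rw [cpsat_stp_end h0 hi χ, cpsat_stp_end h0 hi χ']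
    tauto
end

/-- pointed paths -/
structure Pt (Y : Type) (PR : ℕ∞ → Prop) where
  K : KripkeTree Y
  π : PathW
  i : ℕ
  valid : ValidPath K.T π
  pr : PR π.len
  lt : (i : ℕ∞) < π.len

open Classical in
noncomputable def nx {Y : Type} {PR : ℕ∞ → Prop} (s : Pt Y PR) : Option (Pt Y PR) :=
  if h : ((s.i + 1 : ℕ) : ℕ∞) < s.π.len then some ⟨s.K, s.π, s.i + 1, s.valid, s.pr, h⟩ else none

theorem nx_eq {Y : Type} {PR : ℕ∞ → Prop} {s s' : Pt Y PR} : nx s = some s' ↔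
    ∃ h : ((s.i + 1 : ℕ) : ℕ∞) < s.π.len, s' = ⟨s.K, s.π, s.i + 1, s.valid, s.pr, h⟩ := by
  unfold nx
  split_ifs with h
  · constructor
    · intro e
      cases e
      exact ⟨h, rfl⟩
    · rintro ⟨_, rfl⟩
      rfl
  · constructor
    · intro e
      cases e
    · rintro ⟨h', _⟩
      exact absurd h' h

/-- definable sets of pointed paths -/
def DC (Y : Type) (PR : ℕ∞ → Prop) : Set (Set (Pt Y PR)) :=
  {P | ∃ ψ : CPath Y, ∀ s : Pt Y PR, s ∈ P ↔ cpsat PR s.K ψ s.π s.i}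

theorem dc_closed (Y : Type) (PR : ℕ∞ → Prop) : TClosed (nx (Y := Y) (PR := PR)) (DC Y PR) := by
  refine ⟨⟨.st .tt, fun s => by simp [cpsat, csat]⟩, ?_, ?_, ?_, ?_⟩
  · rintro P ⟨ψ, h⟩
    exact ⟨.not ψ, fun s => by simp only [cpsat]; rw [← h]; rfl⟩
  · rintro P R ⟨ψ, h⟩ ⟨ψ', h'⟩
    exact ⟨.and ψ ψ', fun s => by simp only [cpsat]; rw [← h, ← h']; rfl⟩
  · rintro P ⟨ψ, h⟩
    refine ⟨.X ψ, fun s => ?_⟩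
    simp only [cpsat]
    constructor
    · rintro ⟨s', h1, h2⟩
      obtain ⟨h3, rfl⟩ := nx_eq.1 h1
      exact ⟨h3, (h _).1 h2⟩
    · rintro ⟨h1, h2⟩
      exact ⟨_, nx_eq.2 ⟨h1, rfl⟩, (h _).2 h2⟩
  · rintro P R ⟨ψ, h⟩ ⟨ψ', h'⟩
    refine ⟨.U ψ ψ', fun s => ?_⟩
    constructor
    · intro hs
      change Unt nx P R s at hs
      induction hs with
      | @base s h1 => rw [cpsat_U_unfold s.lt]; exact .inl ((h' s).1 h1)
      | @step s s' h1 h2 _ ih =>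
        rw [cpsat_U_unfold s.lt]
        obtain ⟨h3, rfl⟩ := nx_eq.1 h2
        exact .inr ⟨(h s).1 h1, h3, ih⟩
    · intro hs
      have key : ∀ (d : ℕ) (s : Pt Y PR), (∃ j, j = s.i + d ∧ (j : ℕ∞) < s.π.len ∧
          cpsat PR s.K ψ' s.π j ∧ ∀ k, s.i ≤ k → k < j → cpsat PR s.K ψ s.π k) →
          Unt nx P R s := by
        intro d
        induction d with
        | zero =>
          rintro s ⟨j, rfl, h1, h2, h3⟩
          exact .base ((h' s).2 h2)
        | succ d ih =>
          rintro s ⟨j, rfl, h1, h2, h3⟩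
          have h4 : ((s.i + 1 : ℕ) : ℕ∞) < s.π.len := lt_of_le_lt (by omega) h1
          refine Unt.step ((h s).2 (h3 s.i le_rfl (by omega))) (nx_eq.2 ⟨h4, rfl⟩) (ih _ ?_)
          exact ⟨_, by simp only; ring, h1, h2, fun k hk hk' => h3 k (by simp only at hk; omega) hk'⟩
      simp only [cpsat] at hs
      obtain ⟨j, h1, h2⟩ := hs
      exact key (j - s.i) s ⟨j, by omega, h2⟩

theorem dc_st {Y : Type} {PR : ℕ∞ → Prop} (φ : CState Y) :
    {s : Pt Y PR | csat PR s.K φ (s.π.seq s.i)} ∈ DC Y PR :=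
  ⟨.st φ, fun s => by simp only [cpsat]; rfl⟩

/-! ## Marking a set of nodes by an atom -/

def mk {Y : Type} (K : KripkeTree Y) (p : Y) (M : Set Node) : KripkeTree Y :=
  { K with Lab := fun τ => {y | (y = p ∧ τ ∈ M) ∨ (y ≠ p ∧ y ∈ K.Lab τ)} }

open Classical in
mutual
noncomputable def sbS {Y : Type} (p : Y) : CState Y → CState Y
  | .tt => .tt
  | .atom a => if a = p then .not .tt else .atom a
  | .not φ => .not (sbS p φ)
  | .and φ φ' => .and (sbS p φ) (sbS p φ')
  | .E ψ => .E (sbP p ψ)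
  | .D n φ => .D n (sbS p φ)
noncomputable def sbP {Y : Type} (p : Y) : CPath Y → CPath Y
  | .st φ => .st (sbS p φ)
  | .not φ => .not (sbP p φ)
  | .and φ φ' => .and (sbP p φ) (sbP p φ')
  | .X φ => .X (sbP p φ)
  | .U φ φ' => .U (sbP p φ) (sbP p φ')
end

section
variable {Y : Type} {PR : ℕ∞ → Prop} {K : KripkeTree Y} {p : Y} {M : Set Node}
mutual
theorem offS : ∀ (χ : CState Y) (τ : Node), (∀ σ, τ <+: σ → σ ∉ M) →
    (csat PR (mk K p M) χ τ ↔ csat PR K (sbS p χ) τ)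
  | .tt, τ, h => by simp [csat, sbS]
  | .atom a, τ, h => by
    have := h τ List.prefix_rfl
    simp only [sbS]
    split_ifs with e
    · simp [csat, mk, e, this]
    · simp [csat, mk, e]
  | .not φ, τ, h => by simp only [csat, sbS]; rw [offS φ τ h]
  | .and φ φ', τ, h => by simp only [csat, sbS]; rw [offS φ τ h, offS φ' τ h]
  | .E ψ, τ, h => by
    simp only [csat, sbS]
    refine exists_congr fun π => and_congr_right fun hv => and_congr_right fun _ =>
      and_congr_right fun h0 => ?_
    subst h0
    exact offP ψ π 0 hv hv.1 h
  | .D n φ, τ, h => by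
    simp only [csat, sbS]
    refine exists_congr fun F => and_congr_right fun _ => forall_congr' fun τ' =>
      imp_congr_right fun _ => and_congr_right fun hc => ?_
    obtain ⟨_, n, rfl⟩ := hc
    exact offS φ _ fun σ hσ => h σ ((List.prefix_append _ _).trans hσ)
theorem offP : ∀ (χ : CPath Y) (π : PathW) (i : ℕ), ValidPath K.T π → (i : ℕ∞) < π.len →
    (∀ σ, π.seq 0 <+: σ → σ ∉ M) → (cpsat PR (mk K p M) χ π i ↔ cpsat PR K (sbP p χ) π i)
  | .st φ, π, i, hv, hi, h => by
    simp only [cpsat, sbP]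
    exact offS φ _ fun σ hσ => h σ ((hv.prefix_seq (Nat.zero_le i) hi).trans hσ)
  | .not φ, π, i, hv, hi, h => by simp only [cpsat, sbP]; rw [offP φ π i hv hi h]
  | .and φ φ', π, i, hv, hi, h => by
    simp only [cpsat, sbP]; rw [offP φ π i hv hi h, offP φ' π i hv hi h]
  | .X φ, π, i, hv, hi, h => by
    simp only [cpsat, sbP]
    exact and_congr_right fun hi' => offP φ π (i + 1) hv hi' h
  | .U φ φ', π, i, hv, hi, h => by
    simp only [cpsat, sbP]
    refine exists_congr fun j => and_congr_right fun _ => and_congr_right fun hj =>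
      and_congr (offP φ' π j hv hj h) (forall_congr' fun k => imp_congr_right fun _ =>
        forall_congr' fun hk => offP φ π k hv (lt_of_le_lt hk.le hj) h)
end

end
end Hat1

section Hat2
/-! ## Elimination of the path quantifier -/
section
variable {Y : Type} {PR : ℕ∞ → Prop}

def HS (PR : ℕ∞ → Prop) (p : Y) (χ : CState Y) : Set (Pt Y PR) :=
  {s | csat PR (mk s.K p (nds s.π)) χ (s.π.seq s.i)}
def HP (PR : ℕ∞ → Prop) (p : Y) (χ : CPath Y) : Set (Pt Y PR) :=
  {s | cpsat PR (mk s.K p (nds s.π)) χ s.π s.i}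

/-- child of the current node which is not the next node of the path -/
def OffC (s : Pt Y PR) (c : Node) : Prop :=
  childIn s.K.T (s.π.seq s.i) c ∧ (((s.i + 1 : ℕ) : ℕ∞) < s.π.len → c ≠ s.π.seq (s.i + 1))

theorem OffC.off {s : Pt Y PR} {c : Node} (h : OffC s c) : ∀ σ, c <+: σ → σ ∉ nds s.π := by
  obtain ⟨⟨_, n, rfl⟩, h2⟩ := h
  intro σ hσ hm
  have h0 : s.π.seq 0 <+: s.π.seq s.i ++ [n] :=
    (s.valid.prefix_seq (Nat.zero_le _) s.lt).trans (List.prefix_append _ _)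
  obtain ⟨j, hj, e⟩ := s.valid.mem_of_prefix hm h0 hσ
  have h3 := s.valid.length_seq j hj
  have h4 := s.valid.length_seq s.i s.lt
  rw [e] at h3
  simp at h3
  have : j = s.i + 1 := by omega
  subst this
  exact h2 hj e.symm

def OffCnt (PR : ℕ∞ → Prop) (m : ℕ) (θ : CState Y) : Set (Pt Y PR) :=
  {s | ∃ F : Finset Node, F.card = m ∧ ∀ c ∈ F, OffC s c ∧ csat PR s.K θ c}

theorem offCnt_dc (m : ℕ) (θ : CState Y) : OffCnt PR m θ ∈ DC Y PR := by
  classical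
  have hC := dc_closed Y PR
  have h1 := hC.nxt _ (dc_st (PR := PR) θ)
  have h2 := dc_st (PR := PR) (.D m θ)
  have h3 := dc_st (PR := PR) (.D (m + 1) θ)
  convert hC.union' (hC.inter _ _ (hC.compl _ h1) h2) (hC.inter _ _ h1 h3) using 1
  ext s
  by_cases hx : s ∈ {s : Pt Y PR | ∃ s', nx s = some s' ∧ s' ∈ {s | csat PR s.K θ (s.π.seq s.i)}}
  · have : s ∈ OffCnt PR m θ ↔ csat PR s.K (.D (m + 1) θ) (s.π.seq s.i) := by
      obtain ⟨s', e, hθ⟩ := hx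
      obtain ⟨hl, rfl⟩ := nx_eq.1 e
      simp only [csat]
      constructor
      · rintro ⟨F, hF, h⟩
        refine ⟨insert (s.π.seq (s.i + 1)) F, ?_, ?_⟩
        · rw [Finset.card_insert_of_notMem, hF]
          intro hm
          exact (h _ hm).1.2 hl rfl
        · intro c hc
          rcases Finset.mem_insert.1 hc with rfl | hc
          · exact ⟨⟨s.valid.2.1 _ hl, s.valid.2.2 _ hl⟩, hθ⟩
          · exact ⟨(h c hc).1.1, (h c hc).2⟩
      · rintro ⟨F, hF, h⟩
        have := Finset.pred_card_le_card_erase (s := F) (a := s.π.seq (s.i + 1))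
        obtain ⟨G, hG, hc⟩ := Finset.exists_subset_card_eq (s := F.erase (s.π.seq (s.i + 1))) (n := m) (by omega)
        refine ⟨G, hc, fun c hc => ?_⟩
        have := Finset.mem_erase.1 (hG hc)
        exact ⟨⟨(h c this.2).1, fun _ => this.1⟩, (h c this.2).2⟩
    constructor
    · intro h; exact .inr ⟨hx, this.1 h⟩
    · rintro (h | h)
      · exact absurd hx h.1
      · exact this.2 h.2
  · have : s ∈ OffCnt PR m θ ↔ csat PR s.K (.D m θ) (s.π.seq s.i) := by
      simp only [csat]
      refine exists_congr fun F => and_congr_right fun _ => forall_congr' fun c => imp_congr_right fun _ => ?_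
      constructor
      · intro h; exact ⟨h.1.1, h.2⟩
      · intro h
        refine ⟨⟨h.1, fun hl e => hx ?_⟩, h.2⟩
        exact ⟨_, nx_eq.2 ⟨hl, rfl⟩, by subst e; exact h.2⟩
    constructor
    · intro h; exact .inl ⟨hx, this.1 h⟩
    · rintro (h | h)
      · exact this.2 h.2
      · exact absurd h.1 hx

theorem hs_D {p : Y} {φ : CState Y} (n : ℕ) (h : HS PR p φ ∈ DC Y PR) : HS PR p (.D n φ) ∈ DC Y PR := by
  classical
  have hC := dc_closed Y PR
  rcases n with _ | n
  · convert hC.univ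
    ext s
    simp [HS, csat]
  convert hC.union' (offCnt_dc (n + 1) (sbS p φ)) (hC.inter _ _ (hC.nxt _ h) (offCnt_dc n (sbS p φ))) using 1
  ext s
  have off : ∀ c, OffC s c → (csat PR (mk s.K p (nds s.π)) φ c ↔ csat PR s.K (sbS p φ) c) :=
    fun c hc => offS φ c hc.off
  simp only [HS, csat, Set.mem_setOf_eq]
  constructor
  · rintro ⟨F, hF, h⟩
    by_cases hx : ((s.i + 1 : ℕ) : ℕ∞) < s.π.len ∧ s.π.seq (s.i + 1) ∈ F
    · refine .inr ⟨⟨_, nx_eq.2 ⟨hx.1, rfl⟩, (h _ hx.2).2⟩, F.erase (s.π.seq (s.i + 1)), ?_, ?_⟩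
      · rw [Finset.card_erase_of_mem hx.2, hF]; rfl
      · intro c hc
        have := Finset.mem_erase.1 hc
        have h3 : OffC s c := ⟨(h c this.2).1, fun _ => this.1⟩
        exact ⟨h3, (off c h3).1 (h c this.2).2⟩
    · refine .inl ⟨F, hF, fun c hc => ?_⟩
      have h3 : OffC s c := ⟨(h c hc).1, fun hl e => hx ⟨hl, e ▸ hc⟩⟩
      exact ⟨h3, (off c h3).1 (h c hc).2⟩
  · rintro (⟨F, hF, h⟩ | ⟨⟨s', e, hs'⟩, F, hF, h⟩)
    · exact ⟨F, hF, fun c hc => ⟨(h c hc).1.1, (off c (h c hc).1).2 (h c hc).2⟩⟩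
    · obtain ⟨hl, rfl⟩ := nx_eq.1 e
      refine ⟨insert (s.π.seq (s.i + 1)) F, ?_, ?_⟩
      · rw [Finset.card_insert_of_notMem, hF]
        intro hm
        exact (h _ hm).1.2 hl rfl
      · intro c hc
        rcases Finset.mem_insert.1 hc with rfl | hc
        · exact ⟨⟨s.valid.2.1 _ hl, s.valid.2.2 _ hl⟩, hs'⟩
        · exact ⟨(h c hc).1.1, (off c (h c hc).1).2 (h c hc).2⟩

theorem stp_congr_st {a a' v : CPath Y → Prop} (h : ∀ φ, a (.st φ) ↔ a' (.st φ)) : ∀ χ : CPath Y,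
    (stp a v χ ↔ stp a' v χ)
  | .st φ => h φ
  | .not χ => not_congr (stp_congr_st h χ)
  | .and χ χ' => and_congr (stp_congr_st h χ) (stp_congr_st h χ')
  | .X χ => Iff.rfl
  | .U χ χ' => or_congr (stp_congr_st h χ') (and_congr (stp_congr_st h χ) Iff.rfl)

/-- truth values along a path -/
def vl (PR : ℕ∞ → Prop) (F : Set (CPath Y)) (K : KripkeTree Y) (π : PathW) (i : ℕ) : Vl F :=
  rs F fun χ => cpsat PR K χ π i

def lett (F : Set (CPath Y)) (p : Y) (s : Pt Y PR) : Vl F := vl PR F (mk s.K p (nds s.π)) s.π s.i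

theorem vl_step {ψ : CPath Y} {p : Y} {s : Pt Y PR} {π : PathW} (h0 : π.seq 0 = s.π.seq s.i)
    (h1 : ((1 : ℕ) : ℕ∞) < π.len) : vl PR (psub ψ) (mk s.K p (nds s.π)) π 0 =
      stpF _ (lett (psub ψ) p s) (vl PR (psub ψ) (mk s.K p (nds s.π)) (ptl 1 π) 0) := by
  unfold lett vl
  rw [stpF_rs]
  funext χ
  apply propext
  change cpsat _ _ _ _ _ ↔ stp _ _ _
  rw [cpsat_stp (by simpa using h1)]
  rw [stp_congr_st (a' := fun χ => cpsat PR (mk s.K p (nds s.π)) χ s.π s.i)]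
  · apply stp_congr
    intro ξ _
    refine ⟨Iff.rfl, ?_⟩
    rw [cpsat_ptl (k := 0)]
    simpa using h1
  · intro φ
    simp only [cpsat]
    rw [h0]

theorem vl_end {ψ : CPath Y} {p : Y} {s : Pt Y PR} {π : PathW} (h0 : π.seq 0 = s.π.seq s.i)
    (hp : 0 < π.len)
    (h1 : ¬ ((1 : ℕ) : ℕ∞) < π.len) : vl PR (psub ψ) (mk s.K p (nds s.π)) π 0 =
      stpF _ (lett (psub ψ) p s) (fun _ => False) := by
  unfold lett vl
  have : (fun _ => False : Vl (psub ψ)) = rs (psub ψ) (fun _ => False) := rfl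
  rw [this, stpF_rs]
  funext χ
  apply propext
  change cpsat _ _ _ _ _ ↔ stp _ _ _
  rw [cpsat_stp_end hp (by simpa using h1)]
  rw [stp_congr_st (a' := fun χ => cpsat PR (mk s.K p (nds s.π)) χ s.π s.i)]
  intro φ
  simp only [cpsat]
  rw [h0]

theorem ptl_pcons (τ : Node) (π : PathW) : ptl 1 (pcons τ π) = π := by
  cases π
  rename_i l f
  simp only [ptl, pcons, PathW.mk.injEq, and_true]
  cases l using ENat.recTopCoe with
  | top => rfl
  | coe n => norm_cast

theorem vl_def (F : Set (CPath Y)) (hF : F.Finite) (v : Vl F) : ∃ ξ : CPath Y,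
    ∀ (K : KripkeTree Y) (π : PathW) (i : ℕ), cpsat PR K ξ π i ↔ vl PR F K π i = v := by
  have key : ∃ ξ : CPath Y, ∀ (K : KripkeTree Y) (π : PathW) (i : ℕ), cpsat PR K ξ π i ↔
      ∀ χ ∈ F, (cpsat PR K χ π i ↔ v.ext χ) := by
    generalize v.ext = w
    induction F, hF using Set.Finite.induction_on with
    | empty => exact ⟨.st .tt, fun K π i => by simp [cpsat, csat]⟩
    | @insert a G _ _ ih =>
      obtain ⟨ξ, h⟩ := ih (fun _ => True)
      by_cases ha : w a
      · refine ⟨.and a ξ, fun K π i => ?_⟩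
        simp [cpsat, h, ha]
      · refine ⟨.and (.not a) ξ, fun K π i => ?_⟩
        simp [cpsat, h, ha]
  obtain ⟨ξ, h⟩ := key
  refine ⟨ξ, fun K π i => ?_⟩
  rw [h]
  constructor
  · intro h'
    funext χ
    apply propext
    refine (h' χ.1 χ.2).trans ?_
    simp [Vl.ext]
  · rintro rfl χ hχ
    simp [Vl.ext, vl, rs, hχ]

end
end Hat2

section Hat3
section
variable {Y : Type} {PR : ℕ∞ → Prop}

def Leave (PR : ℕ∞ → Prop) (p : Y) (F : Set (CPath Y)) (v : Vl F) : Set (Pt Y PR) :=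
  {s | ∃ π : PathW, ValidPath s.K.T π ∧ PR π.len ∧ π.seq 0 = s.π.seq s.i ∧
    (((1 : ℕ) : ℕ∞) < π.len → OffC s (π.seq 1)) ∧ vl PR F (mk s.K p (nds s.π)) π 0 = v}

theorem lett_dc {p : Y} {ψ : CPath Y} (h : ∀ χ ∈ psub ψ, HP PR p χ ∈ DC Y PR)
    (A : Set (Vl (psub ψ))) : {s : Pt Y PR | lett (psub ψ) p s ∈ A} ∈ DC Y PR := by
  have hC := dc_closed Y PR
  have := finite_Vl ψ
  have := (psub_finite ψ).to_subtype
  have h1 : ∀ a : Vl (psub ψ), {s : Pt Y PR | lett (psub ψ) p s = a} ∈ DC Y PR := by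
    intro a
    have h2 : ∀ χ : psub ψ, {s : Pt Y PR | lett (psub ψ) p s χ = a χ} ∈ DC Y PR := by
      intro χ
      by_cases ha : a χ
      · convert h χ.1 χ.2 using 1
        ext s
        simp [ha, lett, vl, rs, HP]
      · convert hC.compl _ (h χ.1 χ.2) using 1
        ext s
        simp [ha, lett, vl, rs, HP]
    convert hC.iInter' _ h2 using 1
    ext s
    simp only [Set.mem_iInter]
    exact funext_iff
  convert hC.iUnion' (fun a => {s : Pt Y PR | a ∈ A} ∩ {s : Pt Y PR | lett (psub ψ) p s = a})
    (fun a => hC.inter _ _ (hC.const' _) (h1 a)) using 1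
  ext s
  simp only [Set.mem_iUnion]
  constructor
  · intro hs; exact ⟨_, hs, rfl⟩
  · rintro ⟨a, ha, hs⟩
    change lett _ _ _ = a at hs
    subst hs
    exact ha

theorem leave_dc (hPR : PROK PR) {p : Y} {ψ : CPath Y} (h : ∀ χ ∈ psub ψ, HP PR p χ ∈ DC Y PR)
    (v : Vl (psub ψ)) : Leave PR p (psub ψ) v ∈ DC Y PR := by
  classical
  have hC := dc_closed Y PR
  have := finite_Vl ψ
  choose ξ hξ using fun v' => vl_def (PR := PR) (psub ψ) (psub_finite ψ) v'
  convert hC.union' (lett_dc h {a | stpF _ a (fun _ => False) = v})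
    (hC.iUnion' (fun v' => {s : Pt Y PR | lett (psub ψ) p s ∈ {a | stpF _ a v' = v}} ∩
      OffCnt PR 1 (sbS p (.E (ξ v')))) (fun v' => hC.inter _ _ (lett_dc h _) (offCnt_dc _ _))) using 1
  ext s
  simp only [Set.mem_union, Set.mem_iUnion]
  constructor
  · rintro ⟨π, hv, hpr, h0, hoff, rfl⟩
    by_cases h1 : ((1 : ℕ) : ℕ∞) < π.len
    · right
      refine ⟨vl PR (psub ψ) (mk s.K p (nds s.π)) (ptl 1 π) 0, (vl_step h0 h1).symm, {π.seq 1}, by simp, ?_⟩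
      intro c hc
      rw [Finset.mem_singleton] at hc
      subst hc
      refine ⟨hoff h1, ?_⟩
      rw [← offS (M := nds s.π) _ _ (hoff h1).off]
      simp only [csat]
      exact ⟨ptl 1 π, ptl_valid hv h1, (hPR.sub h1).2 hpr, rfl, (hξ _ _ _ _).2 rfl⟩
    · left
      exact (vl_end h0 hv.1 h1).symm
  · rintro (h1 | ⟨v', h1, F, hF, hc⟩)
    · refine ⟨psing (s.π.seq s.i), psing_valid (s.valid.2.1 _ s.lt), hPR.one, rfl, ?_, ?_⟩
      · intro h
        simp [psing] at h
      · rw [vl_end (π := psing (s.π.seq s.i)) rfl (by simp [psing]) (by simp [psing])]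
        exact h1
    · obtain ⟨c, rfl⟩ := Finset.card_eq_one.1 hF
      obtain ⟨hoff, hs⟩ := hc c (by simp)
      rw [← offS (M := nds s.π) _ _ hoff.off] at hs
      simp only [csat] at hs
      obtain ⟨π, hv, hpr, h0, hs⟩ := hs
      subst h0
      rw [hξ] at hs
      refine ⟨pcons (s.π.seq s.i) π, pcons_valid hv (s.valid.2.1 _ s.lt) hoff.1.2,
        (hPR.succ _).2 hpr, rfl, fun _ => hoff, ?_⟩
      rw [vl_step rfl (pcons_lt.2 hv.1), ptl_pcons, hs]
      exact h1

theorem hs_E (hPR : PROK PR) {p : Y} {ψ : CPath Y} (h : ∀ χ ∈ psub ψ, HP PR p χ ∈ DC Y PR) :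
    HS PR p (.E ψ) ∈ DC Y PR := by
  classical
  have hC := dc_closed Y PR
  have hfin := finite_Vl ψ
  let f : Pt Y PR → Option (Set (Vl (psub ψ)) → Set (Vl (psub ψ))) :=
    fun s => some (Set.preimage (stpF _ (lett (psub ψ) p s)))
  have hf : ∀ g, {s | f s = some g} ∈ DC Y PR := fun g => by
    convert lett_dc h {a | Set.preimage (stpF _ a) = g} using 1
    ext s
    simp [f]
  have hfN : ∀ s g, f s = some g → g ∈ preM (psub ψ) := by
    intro s g e
    simp only [f, Option.some.injEq] at e
    subst e
    exact ⟨_, Cmp.mul _ .one, rfl⟩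
  let Φ0 : Set (Vl (psub ψ)) := {v | v ⟨ψ, psub_self ψ⟩}
  have hR : ∀ (v : Vl (psub ψ)) (Φ : Set (Vl (psub ψ))),
      {s | Reach nx f (Leave PR p (psub ψ) v) Φ0 Φ s} ∈ DC Y PR := fun v Φ =>
    kamp (preM (psub ψ)) (preM_mon _) (preM_aper ψ) hC f hf hfN (leave_dc hPR h v) _ _
  convert hC.union' (h ψ (psub_self ψ)) (hC.iUnion' (fun q : Vl (psub ψ) × Set (Vl (psub ψ)) =>
    {s : Pt Y PR | q.1 ∈ q.2} ∩ {s | Reach nx f (Leave PR p (psub ψ) q.1) Φ0 q.2 s})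
    (fun q => hC.inter _ _ (hC.const' _) (hR _ _))) using 1
  ext s
  simp only [Set.mem_union, Set.mem_iUnion]
  constructor
  · intro hs
    simp only [HS, csat] at hs
    obtain ⟨π, hv, hpr, h0, hψ⟩ := hs
    by_cases hm : ∃ m : ℕ, (m : ℕ∞) < π.len ∧ ((s.i + m : ℕ) : ℕ∞) < s.π.len ∧
      (∀ k ≤ m, π.seq k = s.π.seq (s.i + k)) ∧ (((m + 1 : ℕ) : ℕ∞) < π.len →
        ((s.i + m + 1 : ℕ) : ℕ∞) < s.π.len → π.seq (m + 1) ≠ s.π.seq (s.i + m + 1))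
    · right
      obtain ⟨m, h1, h2, h3, h4⟩ := hm
      have key : ∀ (m : ℕ) (s : Pt Y PR) (π : PathW) (Φ : Set (Vl (psub ψ))), ValidPath s.K.T π →
          PR π.len → vl PR (psub ψ) (mk s.K p (nds s.π)) π 0 ∈ Φ → (m : ℕ∞) < π.len → ((s.i + m : ℕ) : ℕ∞) < s.π.len →
          (∀ k ≤ m, π.seq k = s.π.seq (s.i + k)) → (((m + 1 : ℕ) : ℕ∞) < π.len →
          ((s.i + m + 1 : ℕ) : ℕ∞) < s.π.len → π.seq (m + 1) ≠ s.π.seq (s.i + m + 1)) →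
          ∃ v Φ', v ∈ Φ' ∧ Reach nx f (Leave PR p (psub ψ) v) Φ Φ' s := by
        intro m
        induction m with
        | zero =>
          intro s π Φ hv hpr hΦ h1 h2 h3 h4
          refine ⟨_, Φ, hΦ, .base ⟨π, hv, hpr, h3 0 le_rfl, fun h5 => ?_, rfl⟩⟩
          refine ⟨⟨hv.2.1 _ h5, ?_⟩, fun h6 => h4 h5 h6⟩
          have := h3 0 le_rfl
          simp only [add_zero] at this
          rw [← this]
          exact hv.2.2 0 h5
        | succ m ih =>
          intro s π Φ hv hpr hΦ h1 h2 h3 h4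
          have h5 : ((1 : ℕ) : ℕ∞) < π.len := lt_of_le_lt (by omega) h1
          have h6 : ((s.i + 1 : ℕ) : ℕ∞) < s.π.len := lt_of_le_lt (by omega) h2
          rw [vl_step (h3 0 (by omega)) h5] at hΦ
          obtain ⟨v, Φ', hv', hr⟩ := ih ⟨s.K, s.π, s.i + 1, s.valid, s.pr, h6⟩ (ptl 1 π)
            (Set.preimage (stpF _ (lett (psub ψ) p s)) Φ)
            (ptl_valid hv h5) ((hPR.sub h5).2 hpr) hΦ (ptl_lt.2 h1)
            (by simp only; rw [add_assoc, add_comm 1 m]; exact h2)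
            (fun k hk => by
              simp only [ptl]
              rw [h3 (k + 1) (by omega), add_assoc, add_comm 1 k])
            (fun h7 h8 => by
              simp only [ptl]
              simp only at h8
              have := h4 (ptl_lt.1 h7) (by convert h8 using 3; ring)
              convert this using 2
              ring)
          exact ⟨v, Φ', hv', .step rfl (nx_eq.2 ⟨h6, rfl⟩) hr⟩
      obtain ⟨v, Φ, hv1, hr⟩ := key m s π Φ0 hv hpr hψ h1 h2 h3 h4
      exact ⟨(v, Φ), hv1, hr⟩
    · left
      push Not at hm
      have h1 : ∀ m : ℕ, (m : ℕ∞) < π.len ∧ ((s.i + m : ℕ) : ℕ∞) < s.π.len ∧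
          (∀ k ≤ m, π.seq k = s.π.seq (s.i + k)) := by
        intro m
        induction m with
        | zero =>
          refine ⟨hv.1, s.lt, fun k hk => ?_⟩
          obtain rfl : k = 0 := by omega
          exact h0
        | succ m ih =>
          obtain ⟨a, b, c⟩ := hm m ih.1 ih.2.1 ih.2.2
          refine ⟨a, b, fun k hk => ?_⟩
          rcases Nat.eq_or_lt_of_le hk with rfl | hk
          · exact c
          · exact ih.2.2 k (by omega)
      have := (cpsat_shift (PR := PR) (K := mk s.K p (nds s.π)) (π := π) (π' := s.π) (c := s.i)
        (fun k => ⟨fun _ => by rw [add_comm]; exact (h1 k).2.1, fun _ => (h1 k).1⟩)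
        (fun k _ => by rw [add_comm]; exact (h1 k).2.2 k le_rfl) ψ 0 hv.1).1 hψ
      rw [zero_add] at this
      exact this
  · rintro (hs | ⟨⟨v, Φ⟩, hv, hr⟩)
    · simp only [HS, csat]
      refine ⟨ptl s.i s.π, ptl_valid s.valid s.lt, (hPR.sub s.lt).2 s.pr, by simp [ptl], ?_⟩
      rw [cpsat_ptl _ (by simpa using s.lt), zero_add]
      exact hs
    · change v ∈ Φ at hv
      change Reach nx f (Leave PR p (psub ψ) v) Φ0 Φ s at hr
      have key : ∃ π : PathW, ValidPath s.K.T π ∧ PR π.len ∧ π.seq 0 = s.π.seq s.i ∧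
          vl PR (psub ψ) (mk s.K p (nds s.π)) π 0 ∈ Φ0 := by
        generalize Φ0 = Φ1 at hr
        induction hr with
        | base hs =>
          obtain ⟨π, h1, h2, h3, h4, rfl⟩ := hs
          exact ⟨π, h1, h2, h3, hv⟩
        | @step Φ1 Φ s s' g e1 e2 _ ih =>
          obtain ⟨π, h1, h2, h3, h4⟩ := ih hv
          obtain ⟨hl, rfl⟩ := nx_eq.1 e2
          simp only [f, Option.some.injEq] at e1
          subst e1
          refine ⟨pcons (s.π.seq s.i) π, pcons_valid h1 (s.valid.2.1 _ s.lt) ?_, (hPR.succ _).2 h2, rfl, ?_⟩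
          · rw [h3]; exact s.valid.2.2 _ hl
          · rw [vl_step rfl (pcons_lt.2 h1.1), ptl_pcons]
            exact h4
      obtain ⟨π, h1, h2, h3, h4⟩ := key
      simp only [HS, csat]
      exact ⟨π, h1, h2, h3, h4⟩

mutual
theorem hs_dc (hPR : PROK PR) (p : Y) : ∀ χ : CState Y, HS PR p χ ∈ DC Y PR
  | .tt => by
    convert (dc_closed Y PR).univ
    ext s
    simp [HS, csat]
  | .atom a => by
    by_cases e : a = p
    · convert (dc_closed Y PR).univ
      ext s
      have : s.π.seq s.i ∈ nds s.π := ⟨_, s.lt, rfl⟩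
      simp [HS, csat, mk, e, this]
    · convert dc_st (PR := PR) (.atom a) using 1
      ext s
      simp [HS, csat, mk, e]
  | .not φ => by
    convert (dc_closed Y PR).compl _ (hs_dc hPR p φ) using 1
    ext s
    simp [HS, csat]
  | .and φ φ' => by
    convert (dc_closed Y PR).inter _ _ (hs_dc hPR p φ) (hs_dc hPR p φ') using 1
    ext s
    simp [HS, csat]
  | .E ψ => hs_E hPR (hp_dc hPR p ψ)
  | .D n φ => hs_D n (hs_dc hPR p φ)
theorem hp_dc (hPR : PROK PR) (p : Y) : ∀ ψ : CPath Y, ∀ χ ∈ psub ψ, HP PR p χ ∈ DC Y PR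
  | .st φ => by
    rintro χ rfl
    convert hs_dc hPR p φ using 1
    ext s
    simp [HP, HS, cpsat]
  | .not ψ => by
    rintro χ (rfl | h)
    · convert (dc_closed Y PR).compl _ (hp_dc hPR p ψ ψ (psub_self ψ)) using 1
      ext s
      simp [HP, cpsat]
    · exact hp_dc hPR p ψ χ h
  | .and ψ ψ' => by
    rintro χ (rfl | h | h)
    · convert (dc_closed Y PR).inter _ _ (hp_dc hPR p ψ ψ (psub_self ψ)) (hp_dc hPR p ψ' ψ' (psub_self ψ')) using 1
      ext s
      simp [HP, cpsat]
    · exact hp_dc hPR p ψ χ h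
    · exact hp_dc hPR p ψ' χ h
  | .X ψ => by
    rintro χ (rfl | h)
    · obtain ⟨ξ, h⟩ := hp_dc hPR p ψ ψ (psub_self ψ)
      refine ⟨.X ξ, fun s => ?_⟩
      simp only [HP, cpsat, Set.mem_setOf_eq]
      exact and_congr_right fun hl => h ⟨s.K, s.π, s.i + 1, s.valid, s.pr, hl⟩
    · exact hp_dc hPR p ψ χ h
  | .U ψ ψ' => by
    rintro χ (rfl | h | h)
    · obtain ⟨ξ, h⟩ := hp_dc hPR p ψ ψ (psub_self ψ)
      obtain ⟨ξ', h'⟩ := hp_dc hPR p ψ' ψ' (psub_self ψ')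
      refine ⟨.U ξ ξ', fun s => ?_⟩
      simp only [HP, cpsat, Set.mem_setOf_eq]
      refine exists_congr fun j => and_congr_right fun _ => and_congr_right fun hl =>
        and_congr (h' ⟨s.K, s.π, j, s.valid, s.pr, hl⟩) (forall_congr' fun k =>
          imp_congr_right fun _ => forall_congr' fun hk => 
            h ⟨s.K, s.π, k, s.valid, s.pr, lt_of_le_lt hk.le hl⟩)
    · exact hp_dc hPR p ψ χ h
    · exact hp_dc hPR p ψ' χ h
end

theorem elim_path (hPR : PROK PR) (p : Y) (χ : CState Y) : ∃ χ' : CState Y, ∀ K : KripkeTree Y,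
    csat PR K χ' K.root ↔ ∃ π, ValidPath K.T π ∧ PR π.len ∧ π.seq 0 = K.root ∧
      csat PR (mk K p (nds π)) χ K.root := by
  obtain ⟨ξ, h⟩ := hs_dc hPR p χ
  refine ⟨.E ξ, fun K => ?_⟩
  simp only [csat]
  refine exists_congr fun π => and_congr_right fun hv => and_congr_right fun hpr =>
    and_congr_right fun h0 => ?_
  rw [← h0]
  exact (h ⟨K, π, 0, hv, hpr, hv.1⟩).symm
end
end Hat3

section Enc
/-! ## From MPL to CCTL* -/
section
variable {Y : Type} {PR : ℕ∞ → Prop}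

theorem KripkeTree.closed {K : KripkeTree Y} {σ τ : Node} (hσ : σ ∈ K.T) (h : τ <+: σ)
    (h0 : K.root <+: τ) : τ ∈ K.T := by
  obtain ⟨u, rfl⟩ := h0
  obtain ⟨w, rfl⟩ := K.rooted.2.1 σ hσ
  exact K.rooted.2.2 w u hσ ((List.prefix_append_right_inj _).1 h)

theorem prefix_cases {τ ρ : Node} (h : τ <+: ρ) : τ = ρ ∨ ∃ n, τ ++ [n] <+: ρ := by
  obtain ⟨u, rfl⟩ := h
  rcases u with _ | ⟨n, u⟩
  · left; simp
  · right; exact ⟨n, u, by simp⟩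

theorem not_child_prefix {τ : Node} {n : ℕ} : ¬ (τ ++ [n] <+: τ) := by
  intro h
  have := h.length_le
  simp at this

theorem ext_path (hPR : PROK PR) (K : KripkeTree Y) (π : PathW) (hv : ValidPath K.T π) (hp : PR π.len) :
    ∃ π' : PathW, ValidPath K.T π' ∧ PR π'.len ∧ π'.seq 0 = K.root ∧
      nds π' = {σ | σ ∈ K.T ∧ ∃ ρ ∈ nds π, σ <+: ρ} := by
  obtain ⟨u, hu⟩ := K.rooted.2.1 _ (hv.2.1 0 hv.1)
  induction u using List.reverseRecOn generalizing π with
  | nil =>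
    rw [List.append_nil] at hu
    refine ⟨π, hv, hp, hu.symm, ?_⟩
    ext σ
    constructor
    · intro h; exact ⟨hv.sub h, σ, h, List.prefix_rfl⟩
    · rintro ⟨h1, ρ, h2, h3⟩
      exact hv.mem_of_prefix h2 (hu ▸ K.rooted.2.1 _ h1) h3
  | append_singleton u n ih =>
    have hτ : K.root ++ u ∈ K.T :=
      KripkeTree.closed (hv.2.1 0 hv.1) ⟨[n], by rw [← hu]; simp⟩ (List.prefix_append _ _)
    obtain ⟨π', h1, h2, h3, h4⟩ := ih (pcons (K.root ++ u) π)
      (pcons_valid hv hτ ⟨n, by rw [← hu]; simp⟩) ((hPR.succ _).2 hp) rfl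
    refine ⟨π', h1, h2, h3, ?_⟩
    rw [h4, nds_pcons]
    ext σ
    constructor
    · rintro ⟨h5, ρ, rfl | h6, h7⟩
      · refine ⟨h5, _, hv.zero_mem, h7.trans ⟨[n], by rw [← hu]; simp⟩⟩
      · exact ⟨h5, ρ, h6, h7⟩
    · rintro ⟨h5, ρ, h6, h7⟩
      exact ⟨h5, ρ, .inr h6, h7⟩

theorem ext_node (hPR : PROK PR) (K : KripkeTree Y) {τ : Node} (hτ : τ ∈ K.T) :
    ∃ π' : PathW, ValidPath K.T π' ∧ PR π'.len ∧ π'.seq 0 = K.root ∧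
      nds π' = {σ | σ ∈ K.T ∧ σ <+: τ} := by
  obtain ⟨π, h1, h2, h3, h4⟩ := ext_path hPR K (psing τ) (psing_valid hτ) hPR.one
  refine ⟨π, h1, h2, h3, ?_⟩
  rw [h4, nds_psing]
  ext σ
  simp

def efF (θ : CState Y) : CState Y := .E (.U (.st .tt) (.st θ))
def lastF (p : Y) : CState Y := .and (.atom p) (.not (.D 1 (.atom p)))

theorem csat_ef (hPR : PROK PR) (K : KripkeTree Y) (θ : CState Y) :
    csat PR K (efF θ) K.root ↔ ∃ τ ∈ K.T, csat PR K θ τ := by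
  simp only [efF, csat, cpsat]
  constructor
  · rintro ⟨π, hv, _, _, j, _, hj, h, _⟩
    exact ⟨_, hv.2.1 j hj, h⟩
  · rintro ⟨τ, hτ, h⟩
    obtain ⟨π, hv, hp, h0, hn⟩ := ext_node hPR K hτ
    have : τ ∈ nds π := by rw [hn]; exact ⟨hτ, List.prefix_rfl⟩
    obtain ⟨j, hj, rfl⟩ := this
    exact ⟨π, hv, hp, h0, j, Nat.zero_le _, hj, h, fun _ _ _ => trivial⟩

theorem csat_and (K : KripkeTree Y) (φ ψ : CState Y) (τ : Node) :
    csat PR K (.and φ ψ) τ ↔ csat PR K φ τ ∧ csat PR K ψ τ := by simp only [csat]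
theorem csat_not (K : KripkeTree Y) (φ : CState Y) (τ : Node) :
    csat PR K (.not φ) τ ↔ ¬ csat PR K φ τ := by simp only [csat]
theorem csat_atom (K : KripkeTree Y) (p : Y) (τ : Node) :
    csat PR K (.atom p) τ ↔ p ∈ K.Lab τ := by simp only [csat]

theorem csat_D1 (K : KripkeTree Y) (θ : CState Y) (τ : Node) :
    csat PR K (.D 1 θ) τ ↔ ∃ n, τ ++ [n] ∈ K.T ∧ csat PR K θ (τ ++ [n]) := by
  simp only [csat]
  constructor
  · rintro ⟨F, hF, h⟩
    obtain ⟨c, rfl⟩ := Finset.card_eq_one.1 hF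
    obtain ⟨⟨h1, n, rfl⟩, h2⟩ := h c (by simp)
    exact ⟨n, h1, h2⟩
  · rintro ⟨n, h1, h2⟩
    refine ⟨{τ ++ [n]}, by simp, fun c hc => ?_⟩
    rw [Finset.mem_singleton] at hc
    subst hc
    exact ⟨⟨h1, n, rfl⟩, h2⟩

theorem csat_last (K : KripkeTree Y) (p : Y) (τ : Node) :
    csat PR K (lastF p) τ ↔ p ∈ K.Lab τ ∧ ∀ n, τ ++ [n] ∈ K.T → p ∉ K.Lab (τ ++ [n]) := by
  have h := csat_D1 (PR := PR) K (.atom p) τ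
  simp only [lastF]
  rw [csat_and, csat_not, h]
  simp [csat_atom]

theorem csat_last_of (K : KripkeTree Y) (p : Y) {ρ : Node} (hρ : ρ ∈ K.T)
    (h : ∀ τ ∈ K.T, p ∈ K.Lab τ ↔ τ <+: ρ) {τ : Node} (hτ : τ ∈ K.T) :
    csat PR K (lastF p) τ ↔ τ = ρ := by
  rw [csat_last]
  constructor
  · rintro ⟨h1, h2⟩
    rcases prefix_cases ((h τ hτ).1 h1) with e | ⟨n, hn⟩
    · exact e
    · have hT : τ ++ [n] ∈ K.T := KripkeTree.closed hρ hn ((K.rooted.2.1 _ hτ).trans (List.prefix_append _ _))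
      exact absurd ((h _ hT).2 hn) (h2 n hT)
  · rintro rfl
    exact ⟨(h _ hτ).2 List.prefix_rfl, fun n hn h' => not_child_prefix ((h _ hn).1 h')⟩

/-- a path from the root with a last node -/
theorem last_path {K : KripkeTree Y} {π : PathW} (hv : ValidPath K.T π) (h0 : π.seq 0 = K.root)
    {ρ : Node} (h1 : ρ ∈ nds π) (h2 : ∀ n, ρ ++ [n] ∈ K.T → ρ ++ [n] ∉ nds π) :
    ∀ τ ∈ K.T, τ ∈ nds π ↔ τ <+: ρ := by
  intro τ hτ
  constructor
  · intro h
    rcases hv.chain h h1 with h3 | h3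
    · exact h3
    · rcases prefix_cases h3 with e | ⟨n, hn⟩
      · rw [e]
      · have := hv.mem_of_prefix h ((hv.zero_prefix h1).trans (List.prefix_append _ [n])) hn
        exact absurd this (h2 n (hv.sub this))
  · intro h
    exact hv.mem_of_prefix h1 (h0 ▸ K.rooted.2.1 _ hτ) h

end

section
variable {AP : Type} {PR : ℕ∞ → Prop} {Dm : SODom}

abbrev YY (AP : Type) : Type := AP ⊕ (ℕ ⊕ (ℕ ⊕ ℕ))
abbrev aA (a : AP) : YY AP := .inl a
abbrev aP (x : ℕ) : YY AP := .inr (.inl x)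
abbrev aB (x : ℕ) : YY AP := .inr (.inr (.inl x))
abbrev aT (x : ℕ) : YY AP := .inr (.inr (.inr x))

def RepFO (K' : KripkeTree (YY AP)) (V1 : ℕ → Node) (x : ℕ) : Prop :=
  V1 x ∈ K'.T ∧ ∀ τ ∈ K'.T, aP x ∈ K'.Lab τ ↔ τ <+: V1 x
def RepSO (Dm : SODom) (K' : KripkeTree (YY AP)) (V2 : ℕ → Set Node) (X : ℕ) : Prop :=
  V2 X ∈ Dm K'.T ∧ (∀ τ ∈ K'.T, aB X ∈ K'.Lab τ ↔ ∃ σ ∈ V2 X, τ <+: σ) ∧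
    (∀ τ ∈ K'.T, aT X ∈ K'.Lab τ ↔ ∀ σ ∈ V2 X, τ <+: σ)

structure EncRep (Dm : SODom) (φ : MSOL AP) (K' : KripkeTree (YY AP)) (K : KripkeTree AP)
    (V1 : ℕ → Node) (V2 : ℕ → Set Node) : Prop where
  T : K'.T = K.T
  root : K'.root = K.root
  lab : ∀ τ ∈ K'.T, ∀ a, aA a ∈ K'.Lab τ ↔ a ∈ K.Lab τ
  fo : ∀ x ∈ φ.freeFO, RepFO K' V1 x
  so : ∀ X ∈ φ.freeSO, RepSO Dm K' V2 X

theorem enc_ex (hPR : PROK PR)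
    (hD : ∀ T S, S ∈ Dm T ↔ ∃ π, ValidPath T π ∧ PR π.len ∧ nds π = S) :
    ∀ φ : MSOL AP, ∃ χ : CState (YY AP), ∀ K' K V1 V2, EncRep Dm φ K' K V1 V2 →
      (csat PR K' χ K'.root ↔ Sat Dm K V1 V2 φ)
  | .atom a x => by
    refine ⟨efF (.and (lastF (aP x)) (.atom (aA a))), fun K' K V1 V2 R => ?_⟩
    have h := R.fo x (by simp [MSOL.freeFO])
    rw [csat_ef hPR]
    simp only [Sat]
    constructor
    · rintro ⟨τ, hτ, h'⟩
      rw [csat_and, csat_last_of _ _ h.1 h.2 hτ] at h'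
      obtain ⟨rfl, h2⟩ := h'
      exact ⟨R.T ▸ hτ, (R.lab _ hτ a).1 h2⟩
    · rintro ⟨h1, h2⟩
      refine ⟨V1 x, h.1, ?_⟩
      rw [csat_and, csat_last_of _ _ h.1 h.2 h.1]
      exact ⟨rfl, (R.lab _ h.1 a).2 h2⟩
  | .le x y => by
    refine ⟨efF (.and (lastF (aP x)) (.atom (aP y))), fun K' K V1 V2 R => ?_⟩
    have h := R.fo x (by simp [MSOL.freeFO])
    have h' := R.fo y (by simp [MSOL.freeFO])
    rw [csat_ef hPR]
    simp only [Sat]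
    rw [← R.T]
    constructor
    · rintro ⟨τ, hτ, hh⟩
      rw [csat_and, csat_last_of _ _ h.1 h.2 hτ] at hh
      obtain ⟨rfl, h2⟩ := hh
      exact ⟨hτ, h'.1, (h'.2 _ hτ).1 h2⟩
    · rintro ⟨h1, _, h2⟩
      refine ⟨V1 x, h.1, ?_⟩
      rw [csat_and, csat_last_of _ _ h.1 h.2 h.1]
      exact ⟨rfl, (h'.2 _ h1).2 h2⟩
  | .mem x X => by
    refine ⟨efF (.and (lastF (aP x)) (.and (.atom (aB X)) (.not (.and (.atom (aT X)) (.D 1 (.atom (aT X))))))),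
      fun K' K V1 V2 R => ?_⟩
    have h := R.fo x (by simp [MSOL.freeFO])
    obtain ⟨h1, hB, hA⟩ := R.so X (by simp [MSOL.freeSO])
    obtain ⟨π, hv, hp, hn⟩ := (hD _ _).1 h1
    rw [← hn] at hB hA
    rw [csat_ef hPR]
    simp only [Sat]
    rw [← hn]
    have key : ∀ τ ∈ K'.T, csat PR K' (.and (.atom (aB X)) (.not (.and (.atom (aT X)) (.D 1 (.atom (aT X)))))) τ
        ↔ τ ∈ nds π := by
      intro τ hτ
      rw [csat_and, csat_not, csat_and, csat_D1, csat_atom, csat_atom]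
      constructor
      · rintro ⟨h2, h3⟩
        obtain ⟨ρ, h4, h5⟩ := (hB _ hτ).1 h2
        rcases List.prefix_or_prefix_of_prefix h5 (hv.zero_prefix h4) with h6 | h6
        · rcases prefix_cases h6 with rfl | ⟨n, h7⟩
          · exact hv.zero_mem
          · exfalso
            have hT : τ ++ [n] ∈ K'.T :=
              KripkeTree.closed (hv.2.1 0 hv.1) h7 ((K'.rooted.2.1 _ hτ).trans (List.prefix_append _ _))
            refine h3 ⟨(hA _ hτ).2 fun σ hσ => h6.trans (hv.zero_prefix hσ), n, hT, ?_⟩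
            rw [csat_atom]
            exact (hA _ hT).2 fun σ hσ => h7.trans (hv.zero_prefix hσ)
        · exact hv.mem_of_prefix h4 h6 h5
      · intro h2
        refine ⟨(hB _ hτ).2 ⟨τ, h2, List.prefix_rfl⟩, ?_⟩
        rintro ⟨_, n, hT, h3⟩
        rw [csat_atom] at h3
        exact not_child_prefix ((hA _ hT).1 h3 τ h2)
    constructor
    · rintro ⟨τ, hτ, hh⟩
      rw [csat_and, csat_last_of _ _ h.1 h.2 hτ, key _ hτ] at hh
      obtain ⟨rfl, h2⟩ := hh
      exact h2
    · intro h2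
      refine ⟨V1 x, h.1, ?_⟩
      rw [csat_and, csat_last_of _ _ h.1 h.2 h.1, key _ h.1]
      exact ⟨rfl, h2⟩
  | .not φ => by
    obtain ⟨χ, h⟩ := enc_ex hPR hD φ
    refine ⟨.not χ, fun K' K V1 V2 R => ?_⟩
    simp only [csat, Sat]
    rw [h K' K V1 V2 ⟨R.T, R.root, R.lab, R.fo, R.so⟩]
  | .and φ φ' => by
    obtain ⟨χ, h⟩ := enc_ex hPR hD φ
    obtain ⟨χ', h'⟩ := enc_ex hPR hD φ'
    refine ⟨.and χ χ', fun K' K V1 V2 R => ?_⟩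
    simp only [csat, Sat]
    rw [h K' K V1 V2 ⟨R.T, R.root, R.lab, fun x hx => R.fo x (.inl hx), fun x hx => R.so x (.inl hx)⟩,
      h' K' K V1 V2 ⟨R.T, R.root, R.lab, fun x hx => R.fo x (.inr hx), fun x hx => R.so x (.inr hx)⟩]
  | .exFO x φ => by
    obtain ⟨χ, h⟩ := enc_ex hPR hD φ
    obtain ⟨χ', h'⟩ := elim_path hPR (aP x) (.and (efF (lastF (aP x))) χ)
    refine ⟨χ', fun K' K V1 V2 R => ?_⟩
    rw [h']
    simp only [Sat]
    have key : ∀ (M : Set Node) (τ : Node), τ ∈ K'.T → (∀ σ ∈ K'.T, σ ∈ M ↔ σ <+: τ) →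
        EncRep Dm φ (mk K' (aP x) M) K (Function.update V1 x τ) V2 := by
      intro M τ hτ hM
      refine ⟨R.T, R.root, fun τ hτ a => ?_, fun y hy => ?_, fun X hX => ?_⟩
      · rw [← R.lab τ hτ]
        simp [mk]
      · by_cases e : y = x
        · subst e
          refine ⟨by simpa [mk] using hτ, fun σ hσ => ?_⟩
          have := hM σ hσ
          simpa [mk] using this
        · have := R.fo y ⟨hy, e⟩
          simp only [RepFO, Function.update_of_ne e]
          refine ⟨this.1, fun σ hσ => ?_⟩
          rw [← this.2 σ hσ]
          simp [mk, e]
      · have := R.so X hX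
        refine ⟨this.1, fun σ hσ => ?_, fun σ hσ => ?_⟩
        · rw [← this.2.1 σ hσ]
          simp [mk]
        · rw [← this.2.2 σ hσ]
          simp [mk]
    constructor
    · rintro ⟨π, hv, hp, h0, hs⟩
      rw [csat_and] at hs
      obtain ⟨hs1, hs2⟩ := hs
      obtain ⟨τ, hτ, hs1⟩ := (csat_ef hPR (mk K' (aP x) (nds π)) _).1 hs1
      rw [csat_last] at hs1
      simp only [mk] at hs1
      have hM := last_path hv h0 (ρ := τ) (by simpa using hs1.1) (fun n hn => by simpa using hs1.2 n hn)
      exact ⟨τ, R.T ▸ hτ, (h _ _ _ _ (key _ τ hτ hM)).1 hs2⟩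
    · rintro ⟨τ, hτ, hs⟩
      rw [← R.T] at hτ
      obtain ⟨π, hv, hp, h0, hn⟩ := ext_node hPR K' hτ
      have hM : ∀ σ ∈ K'.T, σ ∈ nds π ↔ σ <+: τ := by
        intro σ hσ
        rw [hn]
        exact ⟨fun h => h.2, fun h => ⟨hσ, h⟩⟩
      refine ⟨π, hv, hp, h0, ?_⟩
      rw [csat_and]
      refine ⟨(csat_ef hPR (mk K' (aP x) (nds π)) _).2 ⟨τ, hτ, ?_⟩, (h _ _ _ _ (key _ τ hτ hM)).2 hs⟩
      refine (csat_last_of (mk K' (aP x) (nds π)) (aP x) (ρ := τ) hτ ?_ hτ).2 rfl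
      intro σ hσ
      have := hM σ hσ
      simpa [mk] using this
  | .exSO X φ => by
    obtain ⟨χ, h⟩ := enc_ex hPR hD φ
    obtain ⟨χ1, h1⟩ := elim_path hPR (aT X) (.and (.and (efF (lastF (aT X)))
      (.not (efF (.and (.atom (aT X)) (.not (.atom (aB X))))))) χ)
    obtain ⟨χ2, h2⟩ := elim_path hPR (aB X) χ1
    refine ⟨χ2, fun K' K V1 V2 R => ?_⟩
    rw [h2]
    simp only [Sat]
    have key : ∀ (M M' S : Set Node), S ∈ Dm K'.T → (∀ σ ∈ K'.T, σ ∈ M ↔ ∃ ρ ∈ S, σ <+: ρ) →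
        (∀ σ ∈ K'.T, σ ∈ M' ↔ ∀ ρ ∈ S, σ <+: ρ) →
        EncRep Dm φ (mk (mk K' (aB X) M) (aT X) M') K V1 (Function.update V2 X S) := by
      intro M M' S hS hM hM'
      refine ⟨R.T, R.root, fun τ hτ a => ?_, fun y hy => ?_, fun y hy => ?_⟩
      · rw [← R.lab τ hτ]
        simp [mk]
      · have := R.fo y hy
        refine ⟨this.1, fun σ hσ => ?_⟩
        rw [← this.2 σ hσ]
        simp [mk]
      · by_cases e : y = X
        · subst e
          refine ⟨by simpa [mk] using hS, fun σ hσ => ?_, fun σ hσ => ?_⟩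
          · have := hM σ hσ
            simpa [mk] using this
          · have := hM' σ hσ
            simpa [mk] using this
        · have := R.so y ⟨hy, e⟩
          simp only [RepSO, Function.update_of_ne e]
          refine ⟨this.1, fun σ hσ => ?_, fun σ hσ => ?_⟩
          · rw [← this.2.1 σ hσ]
            simp [mk, e]
          · rw [← this.2.2 σ hσ]
            simp [mk, e]
    constructor
    · rintro ⟨π, hv, hp, h0, hs⟩
      obtain ⟨π', hv', hp', h0', hs⟩ := (h1 (mk K' (aB X) (nds π))).1 hs
      rw [csat_and, csat_and, csat_not] at hs
      obtain ⟨⟨hs1, hs2⟩, hs3⟩ := hs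
      have hs1 := (csat_ef hPR (mk (mk K' (aB X) (nds π)) (aT X) (nds π')) _).1 hs1
      have hs2 := (not_congr (csat_ef hPR (mk (mk K' (aB X) (nds π)) (aT X) (nds π')) _)).1 hs2
      obtain ⟨τ, hτ, hs1⟩ := hs1
      change τ ∈ K'.T at hτ
      change ValidPath K'.T π' at hv'
      change π'.seq 0 = K'.root at h0'
      rw [csat_last] at hs1
      simp only [mk] at hs1
      have hM := last_path hv' h0' (ρ := τ) (by simpa using hs1.1) (fun n hn => by simpa using hs1.2 n hn)
      have hτπ : τ ∈ nds π := by
        by_contra hc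
        refine hs2 ⟨τ, hτ, ?_⟩
        have : τ ∈ nds π' := (hM τ hτ).2 List.prefix_rfl
        simp [csat, mk, hc, this]
      obtain ⟨n, hn, rfl⟩ := hτπ
      have hnd := nds_ptl hv hn
      have hS : nds (ptl n π) ∈ Dm K'.T :=
        (hD _ _).2 ⟨_, ptl_valid hv hn, (hPR.sub hn).2 hp, rfl⟩
      have hself : π.seq n ∈ nds (ptl n π) := by rw [hnd]; exact ⟨⟨n, hn, rfl⟩, List.prefix_rfl⟩
      refine ⟨_, R.T ▸ hS, (h _ _ _ _ (key (nds π) (nds π') _ hS ?_ ?_)).1 hs3⟩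
      · intro σ hσ
        constructor
        · intro h
          rcases hv.chain h ⟨n, hn, rfl⟩ with h3 | h3
          · exact ⟨_, hself, h3⟩
          · exact ⟨σ, by rw [hnd]; exact ⟨h, h3⟩, List.prefix_rfl⟩
        · rintro ⟨ρ, h3, h4⟩
          rw [hnd] at h3
          exact hv.mem_of_prefix h3.1 (h0 ▸ K'.rooted.2.1 _ hσ) h4
      · intro σ hσ
        rw [hM σ hσ]
        constructor
        · intro h3 ρ h4
          rw [hnd] at h4
          exact h3.trans h4.2
        · intro h3
          exact h3 _ hself
    · rintro ⟨S, hS, hs⟩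
      rw [← R.T] at hS
      obtain ⟨π, hv, hp, hnS⟩ := (hD _ _).1 hS
      obtain ⟨πB, hvB, hpB, h0B, hnB⟩ := ext_path hPR K' π hv hp
      obtain ⟨πA, hvA, hpA, h0A, hnA⟩ := ext_node hPR K' (hv.2.1 0 hv.1)
      refine ⟨πB, hvB, hpB, h0B, (h1 (mk K' (aB X) (nds πB))).2 ⟨πA, hvA, hpA, h0A, ?_⟩⟩
      have hA : ∀ σ ∈ K'.T, σ ∈ nds πA ↔ σ <+: π.seq 0 := by
        intro σ hσ
        rw [hnA]
        exact ⟨fun h => h.2, fun h => ⟨hσ, h⟩⟩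
      have hAS : ∀ σ ∈ K'.T, σ ∈ nds πA ↔ ∀ ρ ∈ S, σ <+: ρ := by
        intro σ hσ
        rw [hA σ hσ, ← hnS]
        exact ⟨fun h ρ hρ => h.trans (hv.zero_prefix hρ), fun h => h _ hv.zero_mem⟩
      have hB : ∀ σ ∈ K'.T, σ ∈ nds πB ↔ ∃ ρ ∈ S, σ <+: ρ := by
        intro σ hσ
        rw [hnB, hnS]
        exact ⟨fun h => h.2, fun h => ⟨hσ, h⟩⟩
      rw [csat_and, csat_and, csat_not]
      refine ⟨⟨?_, ?_⟩, (h _ _ _ _ (key _ _ S hS hB hAS)).2 hs⟩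
      · refine (csat_ef hPR (mk (mk K' (aB X) (nds πB)) (aT X) (nds πA)) _).2 ⟨π.seq 0, hv.2.1 0 hv.1, ?_⟩
        refine (csat_last_of (mk (mk K' (aB X) (nds πB)) (aT X) (nds πA)) (aT X) (ρ := π.seq 0)
          (hv.2.1 0 hv.1) ?_ (hv.2.1 0 hv.1)).2 rfl
        intro σ hσ
        have := hA σ hσ
        simpa [mk] using this
      · refine (not_congr (csat_ef hPR (mk (mk K' (aB X) (nds πB)) (aT X) (nds πA)) _)).2 ?_
        rintro ⟨τ, hτ, hh⟩
        have e1 := hA τ hτ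
        have e2 := hB τ hτ
        simp [csat, mk] at hh
        apply hh.2
        rw [e2, ← hnS]
        exact ⟨_, hv.zero_mem, e1.1 hh.1⟩

/-! removing auxiliary atoms -/
mutual
def dS : CState (YY AP) → CState AP
  | .tt => .tt
  | .atom (.inl a) => .atom a
  | .atom (.inr _) => .not .tt
  | .not φ => .not (dS φ)
  | .and φ φ' => .and (dS φ) (dS φ')
  | .E ψ => .E (dP ψ)
  | .D n φ => .D n (dS φ)
def dP : CPath (YY AP) → CPath AP
  | .st φ => .st (dS φ)
  | .not φ => .not (dP φ)
  | .and φ φ' => .and (dP φ) (dP φ')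
  | .X φ => .X (dP φ)
  | .U φ φ' => .U (dP φ) (dP φ')
end

def lift (K : KripkeTree AP) : KripkeTree (YY AP) :=
  ⟨K.T, K.root, K.rooted, K.nonblocking, fun τ => Sum.inl '' K.Lab τ⟩

mutual
theorem dS_sat (K : KripkeTree AP) : ∀ (φ : CState (YY AP)) (τ : Node),
    csat PR K (dS φ) τ ↔ csat PR (lift K) φ τ
  | .tt, τ => by simp [dS, csat]
  | .atom (.inl a), τ => by simp [dS, csat, lift]
  | .atom (.inr _), τ => by simp [dS, csat, lift]
  | .not φ, τ => by simp only [dS, csat]; rw [dS_sat K φ]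
  | .and φ φ', τ => by simp only [dS, csat]; rw [dS_sat K φ, dS_sat K φ']
  | .E ψ, τ => by
    simp only [dS, csat]
    exact exists_congr fun π => and_congr_right fun _ => and_congr_right fun _ =>
      and_congr_right fun _ => dP_sat K ψ π 0
  | .D n φ, τ => by
    simp only [dS, csat]
    exact exists_congr fun F => and_congr_right fun _ => forall_congr' fun c => imp_congr_right fun _ =>
      and_congr_right fun _ => dS_sat K φ c
theorem dP_sat (K : KripkeTree AP) : ∀ (φ : CPath (YY AP)) (π : PathW) (i : ℕ),
    cpsat PR K (dP φ) π i ↔ cpsat PR (lift K) φ π i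
  | .st φ, π, i => by simp only [dP, cpsat]; rw [dS_sat K φ]
  | .not φ, π, i => by simp only [dP, cpsat]; rw [dP_sat K φ]
  | .and φ φ', π, i => by simp only [dP, cpsat]; rw [dP_sat K φ, dP_sat K φ']
  | .X φ, π, i => by simp only [dP, cpsat]; rw [dP_sat K φ]
  | .U φ φ', π, i => by
    simp only [dP, cpsat]
    exact exists_congr fun j => and_congr_right fun _ => and_congr_right fun _ =>
      and_congr (dP_sat K φ' π j) (forall_congr' fun k => imp_congr_right fun _ =>
        imp_congr_right fun _ => dP_sat K φ π k)
end

theorem mpl_to_cctl (hPR : PROK PR)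
    (hD : ∀ T S, S ∈ Dm T ↔ ∃ π, ValidPath T π ∧ PR π.len ∧ nds π = S) (φ : MSOL AP)
    (hφ : φ.IsSentence) : ∃ ξ : CState AP, ∀ K : KripkeTree AP,
      ((∃ V1 V2, Sat Dm K V1 V2 φ) ↔ CKSat PR K ξ) := by
  obtain ⟨χ, h⟩ := enc_ex hPR hD φ
  refine ⟨dS χ, fun K => ?_⟩
  have key : ∀ V1 V2, Sat Dm K V1 V2 φ ↔ CKSat PR K (dS χ) := by
    intro V1 V2
    rw [CKSat, dS_sat]
    refine (h (lift K) K V1 V2 ⟨rfl, rfl, fun τ _ a => ?_, fun x hx => ?_, fun x hx => ?_⟩).symm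
    · simp [lift]
    · rw [hφ.1] at hx; exact hx.elim
    · rw [hφ.2] at hx; exact hx.elim
  constructor
  · rintro ⟨V1, V2, h⟩
    exact (key _ _).1 h
  · intro h
    exact ⟨fun _ => [], fun _ => ∅, (key _ _).2 h⟩
end
end Enc

section Dec
/-! ## From CCTL* to MPL -/
section
variable {AP : Type}

def chF (x y z : ℕ) : MSOL AP :=
  .and (.le x y) (.and (.not (.le y x)) (.not (.exFO z (.and (.le x z) (.and (.le z y)
    (.and (.not (.le z x)) (.not (.le y z))))))))

def neqF (x y : ℕ) : ℕ → MSOL AP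
  | 0 => .le y y
  | m + 1 => .and (neqF x y m) (.not (.le y (x + m + 1)))

def dF (g : ℕ → MSOL AP) (x : ℕ) : ℕ → ℕ → MSOL AP
  | 0, _ => .le x x
  | k + 1, m => .exFO (x + m + 1) (.and (chF x (x + m + 1) (x + m + 2))
      (.and (neqF x (x + m + 1) m) (.and (g (x + m + 1)) (dF g x k (m + 1)))))

mutual
def trS : CState AP → ℕ → MSOL AP
  | .tt, x => .le x x
  | .atom a, x => .atom a x
  | .not φ, x => .not (trS φ x)
  | .and φ φ', x => .and (trS φ x) (trS φ' x)
  | .E ψ, x => .exSO 0 (.and (.and (.mem x 0)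
      (.not (.exFO (x + 1) (.and (.mem (x + 1) 0) (.not (.le x (x + 1))))))) (trP ψ x))
  | .D n φ, x => dF (trS φ) x n 0
def trP : CPath AP → ℕ → MSOL AP
  | .st φ, x => trS φ x
  | .not ψ, x => .not (trP ψ x)
  | .and ψ ψ', x => .and (trP ψ x) (trP ψ' x)
  | .X ψ, x => .exFO (x + 1) (.and (.mem (x + 1) 0) (.and (chF x (x + 1) (x + 2)) (trP ψ (x + 1))))
  | .U ψ ψ', x => .exFO (x + 1) (.and (.and (.le x (x + 1)) (.mem (x + 1) 0)) (.and (trP ψ' (x + 1))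
      (.not (.exFO (x + 2) (.and (.le x (x + 2)) (.and (.le (x + 2) (x + 1))
        (.and (.not (.le (x + 1) (x + 2))) (.not (trP ψ (x + 2))))))))))
end

/-! free variables -/

theorem chF_fo {x y z : ℕ} : (chF x y z : MSOL AP).freeFO ⊆ {x, y} := by
  intro w
  simp only [chF, MSOL.freeFO, Set.mem_union, Set.mem_insert_iff, Set.mem_singleton_iff, Set.mem_diff]
  omega

theorem chF_so {x y z : ℕ} : (chF x y z : MSOL AP).freeSO = ∅ := by simp [chF, MSOL.freeSO]

theorem neqF_fo {x y m : ℕ} : ∀ w ∈ (neqF x y m : MSOL AP).freeFO, w = y ∨ (x ≤ w ∧ w ≤ x + m) := by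
  induction m with
  | zero => simp [neqF, MSOL.freeFO]
  | succ m ih =>
    intro w hw
    simp only [neqF, MSOL.freeFO, Set.mem_union, Set.mem_insert_iff, Set.mem_singleton_iff] at hw
    rcases hw with h | h
    · have := ih w h; omega
    · omega

theorem neqF_so {x y m : ℕ} : (neqF x y m : MSOL AP).freeSO = ∅ := by
  induction m with
  | zero => simp [neqF, MSOL.freeSO]
  | succ m ih => simp [neqF, MSOL.freeSO, ih]

theorem dF_fo {g : ℕ → MSOL AP} (hg : ∀ x, (g x).freeFO ⊆ {x}) {x k : ℕ} :
    ∀ m, ∀ w ∈ (dF g x k m).freeFO, x ≤ w ∧ w ≤ x + m := by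
  induction k with
  | zero => intro m w; simp [dF, MSOL.freeFO]; omega
  | succ k ih =>
    intro m w hw
    simp only [dF, MSOL.freeFO, Set.mem_union, Set.mem_singleton_iff, Set.mem_diff] at hw
    obtain ⟨h | h | h | h, h'⟩ := hw
    · have := chF_fo h
      simp only [Set.mem_insert_iff, Set.mem_singleton_iff] at this
      omega
    · have := neqF_fo _ h; omega
    · have := hg _ h
      simp only [Set.mem_singleton_iff] at this
      omega
    · have := ih _ _ h; omega

theorem dF_so {g : ℕ → MSOL AP} (hg : ∀ x, (g x).freeSO = ∅) {x k : ℕ} :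
    ∀ m, (dF g x k m).freeSO = ∅ := by
  induction k with
  | zero => intro m; simp [dF, MSOL.freeSO]
  | succ k ih => intro m; simp [dF, MSOL.freeSO, ih, hg, chF_so, neqF_so]

mutual
theorem trS_fo : ∀ (φ : CState AP) (x : ℕ), (trS φ x).freeFO ⊆ {x}
  | .tt, x => by simp [trS, MSOL.freeFO]
  | .atom a, x => by simp [trS, MSOL.freeFO]
  | .not φ, x => by simpa only [trS, MSOL.freeFO] using trS_fo φ x
  | .and φ φ', x => by
    simp only [trS, MSOL.freeFO]
    exact Set.union_subset (trS_fo φ x) (trS_fo φ' x)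
  | .E ψ, x => by
    have := trP_fo ψ x
    simp only [trS, MSOL.freeFO]
    refine Set.union_subset ?_ this
    intro w
    simp

  | .D n φ, x => by
    intro w hw
    have := dF_fo (fun y => trS_fo φ y) 0 w hw
    simp only [Set.mem_singleton_iff]
    omega
theorem trP_fo : ∀ (φ : CPath AP) (x : ℕ), (trP φ x).freeFO ⊆ {x}
  | .st φ, x => by simpa only [trP] using trS_fo φ x
  | .not φ, x => by simpa only [trP, MSOL.freeFO] using trP_fo φ x
  | .and φ φ', x => by
    simp only [trP, MSOL.freeFO]
    exact Set.union_subset (trP_fo φ x) (trP_fo φ' x)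
  | .X φ, x => by
    intro w hw
    simp only [trP, MSOL.freeFO, Set.mem_union, Set.mem_singleton_iff, Set.mem_diff] at hw ⊢
    obtain ⟨h | h | h, h'⟩ := hw
    · omega
    · have := chF_fo h
      simp only [Set.mem_insert_iff, Set.mem_singleton_iff] at this
      omega
    · have := trP_fo φ _ h
      simp only [Set.mem_singleton_iff] at this
      omega
  | .U φ φ', x => by
    intro w hw
    have h1 := @trP_fo φ (x + 2) w
    have h2 := @trP_fo φ' (x + 1) w
    simp only [trP, MSOL.freeFO, Set.mem_union, Set.mem_singleton_iff, Set.mem_diff, Set.mem_insert_iff] at hw h1 h2 ⊢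
    grind
end

mutual
theorem trS_so : ∀ (φ : CState AP) (x : ℕ), (trS φ x).freeSO = ∅
  | .tt, x => by simp [trS, MSOL.freeSO]
  | .atom a, x => by simp [trS, MSOL.freeSO]
  | .not φ, x => by simpa only [trS, MSOL.freeSO] using trS_so φ x
  | .and φ φ', x => by
    simp only [trS, MSOL.freeSO, trS_so φ x, trS_so φ' x, Set.union_empty]
  | .E ψ, x => by
    have := trP_so ψ x
    simp only [trS, MSOL.freeSO, Set.diff_eq_empty]
    refine Set.union_subset ?_ this
    simp
  | .D n φ, x => by
    simp only [trS]
    exact dF_so (fun y => trS_so φ y) 0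
theorem trP_so : ∀ (φ : CPath AP) (x : ℕ), (trP φ x).freeSO ⊆ {0}
  | .st φ, x => by simp only [trP, trS_so φ x, Set.empty_subset]
  | .not φ, x => by simpa only [trP, MSOL.freeSO] using trP_so φ x
  | .and φ φ', x => by
    simp only [trP, MSOL.freeSO]
    exact Set.union_subset (trP_so φ x) (trP_so φ' x)
  | .X φ, x => by
    have := trP_so φ (x + 1)
    simp only [trP, MSOL.freeSO, chF_so]
    simpa using this
  | .U φ φ', x => by
    have := trP_so φ (x + 2)
    have := trP_so φ' (x + 1)
    simp only [trP, MSOL.freeSO]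
    simp_all
    rintro a (h | h)
    · exact this _ h
    · exact trP_so φ (x + 2) h
end

/-! semantics -/
variable {Dm : SODom} {PR : ℕ∞ → Prop} {K : KripkeTree AP}

theorem upd_ne {α : Type} {V : ℕ → α} {x y : ℕ} {a : α} (h : y ≠ x) : Function.update V x a y = V y :=
  Function.update_of_ne h _ _

theorem chF_sat {V1 : ℕ → Node} {V2 : ℕ → Set Node} {x y z : ℕ} (hx : V1 x ∈ K.T) (hy : V1 y ∈ K.T)
    (hzx : x ≠ z) (hzy : y ≠ z) :
    Sat Dm K V1 V2 (chF x y z) ↔ childIn K.T (V1 x) (V1 y) := by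
  simp only [chF, Sat, Function.update_self, upd_ne hzx, upd_ne hzy]
  constructor
  · rintro ⟨⟨_, _, h1⟩, h2, h3⟩
    refine ⟨hy, ?_⟩
    rcases prefix_cases h1 with e | ⟨n, hn⟩
    · exact absurd ⟨hy, hx, e ▸ List.prefix_rfl⟩ h2
    · refine ⟨n, ?_⟩
      have hT : V1 x ++ [n] ∈ K.T := KripkeTree.closed hy hn ((K.rooted.2.1 _ hx).trans (List.prefix_append _ _))
      by_contra hne
      refine h3 ⟨_, hT, ⟨hx, hT, List.prefix_append _ _⟩, ⟨hT, hy, hn⟩,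
        fun h => not_child_prefix h.2.2, fun h => hne ?_⟩
      exact h.2.2.eq_of_length (le_antisymm h.2.2.length_le hn.length_le)
  · rintro ⟨_, n, e⟩
    refine ⟨⟨hx, hy, e ▸ List.prefix_append _ _⟩, fun h => ?_, ?_⟩
    · have := h.2.2; rw [e] at this; exact not_child_prefix this
    · rintro ⟨τ, hτ, h1, h2, h3, h4⟩
      have a1 := h1.2.2
      have a2 := h2.2.2
      have l2 := a2.length_le
      rw [e] at l2
      simp at l2
      rcases prefix_cases a1 with e' | ⟨m, hm⟩
      · exact h3 ⟨hτ, hx, e' ▸ List.prefix_rfl⟩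
      · have l3 := hm.length_le
        simp at l3
        have : τ = V1 y := a2.eq_of_length (by rw [e]; simp; omega)
        exact h4 ⟨hy, hτ, this ▸ List.prefix_rfl⟩

theorem child_le {T : Set Node} {τ c c' : Node} (h : childIn T τ c) (h' : childIn T τ c') :
    c <+: c' ↔ c = c' := by
  obtain ⟨_, n, rfl⟩ := h
  obtain ⟨_, m, rfl⟩ := h'
  constructor
  · intro h; exact h.eq_of_length (by simp)
  · intro h; rw [h]

theorem neqF_sat {V1 : ℕ → Node} {V2 : ℕ → Set Node} {x y : ℕ} {τ : Node} (hy : childIn K.T τ (V1 y)) :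
    ∀ m, (∀ j < m, childIn K.T τ (V1 (x + j + 1))) →
    (Sat Dm K V1 V2 (neqF x y m) ↔ ∀ j < m, V1 y ≠ V1 (x + j + 1)) := by
  intro m
  induction m with
  | zero => intro _; simpa [neqF, Sat] using hy.1
  | succ m ih =>
    intro h
    simp only [neqF, Sat]
    rw [ih fun j hj => h j (by omega)]
    have hm := h m (by omega)
    have := child_le hy hm
    constructor
    · rintro ⟨h1, h2⟩ j hj
      rcases Nat.lt_succ_iff_lt_or_eq.1 hj with hj | rfl
      · exact h1 j hj
      · intro e
        exact h2 ⟨hy.1, hm.1, this.2 e⟩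
    · intro h1
      exact ⟨fun j hj => h1 j (by omega), fun h2 => h1 m (by omega) (this.1 h2.2.2)⟩

theorem dF_sat {g : ℕ → MSOL AP} {P : Node → Prop}
    (hg : ∀ (V1 : ℕ → Node) (V2 : ℕ → Set Node) (x : ℕ), V1 x ∈ K.T → (Sat Dm K V1 V2 (g x) ↔ P (V1 x)))
    {x : ℕ} {V2 : ℕ → Set Node} : ∀ (k m : ℕ) (V1 : ℕ → Node), V1 x ∈ K.T →
    (∀ j < m, childIn K.T (V1 x) (V1 (x + j + 1))) →
    (Sat Dm K V1 V2 (dF g x k m) ↔ ∃ F : Finset Node, F.card = k ∧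
      ∀ c ∈ F, (childIn K.T (V1 x) c ∧ P c) ∧ ∀ j < m, c ≠ V1 (x + j + 1)) := by
  classical
  intro k
  induction k with
  | zero =>
    intro m V1 hx h
    simp only [dF, Sat]
    exact ⟨fun _ => ⟨∅, rfl, by simp⟩, fun _ => ⟨hx, hx, List.prefix_rfl⟩⟩
  | succ k ih =>
    intro m V1 hx h
    have main : ∀ τ, childIn K.T (V1 x) τ →
        (Sat Dm K (Function.update V1 (x + m + 1) τ) V2 (.and (neqF x (x + m + 1) m)
          (.and (g (x + m + 1)) (dF g x k (m + 1)))) ↔ (∀ j < m, τ ≠ V1 (x + j + 1)) ∧ P τ ∧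
          ∃ F : Finset Node, F.card = k ∧ ∀ c ∈ F, (childIn K.T (V1 x) c ∧ P c) ∧
            c ≠ τ ∧ ∀ j < m, c ≠ V1 (x + j + 1)) := by
      intro τ hτ
      have e1 : Function.update V1 (x + m + 1) τ x = V1 x := upd_ne (by omega)
      have e2 : ∀ j < m, Function.update V1 (x + m + 1) τ (x + j + 1) = V1 (x + j + 1) :=
        fun j hj => upd_ne (by omega)
      simp only [Sat]
      rw [neqF_sat (τ := V1 x) (by simpa using hτ) m (fun j hj => by rw [e2 j hj]; exact h j hj),
        hg _ _ _ (by simpa using hτ.1), ih (m + 1) _ (by rw [e1]; exact hx) ?_]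
      · rw [e1]
        simp only [Function.update_self]
        refine and_congr (forall_congr' fun j => forall_congr' fun hj => by rw [e2 j hj])
          (and_congr_right fun _ => exists_congr fun F => and_congr_right fun _ =>
          forall_congr' fun c => imp_congr_right fun _ => and_congr_right fun _ => ?_)
        constructor
        · intro h1
          refine ⟨by simpa using h1 m (by omega), fun j hj => ?_⟩
          rw [← e2 j hj]
          exact h1 j (by omega)
        · rintro ⟨h1, h2⟩ j hj
          rcases Nat.lt_succ_iff_lt_or_eq.1 hj with hj | rfl
          · rw [e2 j hj]; exact h2 j hj
          · simpa using h1
      · intro j hj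
        rw [e1]
        rcases Nat.lt_succ_iff_lt_or_eq.1 hj with hj | rfl
        · rw [e2 j hj]; exact h j hj
        · simpa using hτ
    have main2 : Sat Dm K V1 V2 (dF g x (k + 1) m) ↔ ∃ τ, childIn K.T (V1 x) τ ∧
        (∀ j < m, τ ≠ V1 (x + j + 1)) ∧ P τ ∧
          ∃ F : Finset Node, F.card = k ∧ ∀ c ∈ F, (childIn K.T (V1 x) c ∧ P c) ∧
            c ≠ τ ∧ ∀ j < m, c ≠ V1 (x + j + 1) := by
      rw [dF, Sat]
      have e : ∀ τ ∈ K.T, (Sat Dm K (Function.update V1 (x + m + 1) τ) V2 (chF x (x + m + 1) (x + m + 2)) ↔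
          childIn K.T (V1 x) τ) := by
        intro τ hτ
        rw [chF_sat (by rw [upd_ne (by omega)]; exact hx) (by simpa using hτ) (by omega) (by omega)]
        rw [upd_ne (by omega), Function.update_self]
      constructor
      · rintro ⟨τ, hτ, hs⟩
        rw [Sat] at hs
        have hc := (e τ hτ).1 hs.1
        exact ⟨τ, hc, (main τ hc).1 hs.2⟩
      · rintro ⟨τ, hc, hs⟩
        refine ⟨τ, hc.1, ?_⟩
        rw [Sat]
        exact ⟨(e τ hc.1).2 hc, (main τ hc).2 hs⟩
    rw [main2]
    constructor
    · rintro ⟨τ, hc, h1, h2, F, hF, h3⟩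
      refine ⟨insert τ F, ?_, ?_⟩
      · rw [Finset.card_insert_of_notMem, hF]
        intro h4
        exact (h3 τ h4).2.1 rfl
      · intro c h4
        rcases Finset.mem_insert.1 h4 with rfl | h4
        · exact ⟨⟨hc, h2⟩, h1⟩
        · exact ⟨(h3 c h4).1, (h3 c h4).2.2⟩
    · rintro ⟨F, hF, h1⟩
      obtain ⟨τ, hτ⟩ := Finset.card_pos.1 (by omega : 0 < F.card)
      refine ⟨τ, (h1 τ hτ).1.1, (h1 τ hτ).2, (h1 τ hτ).1.2, F.erase τ, ?_, fun c hc => ?_⟩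
      · rw [Finset.card_erase_of_mem hτ, hF]; rfl
      · have := Finset.mem_erase.1 hc
        exact ⟨(h1 c this.2).1, this.1, (h1 c this.2).2⟩

theorem ValidPath.prefix_iff {T : Set Node} {π : PathW} (hv : ValidPath T π) {i j : ℕ}
    (hi : (i : ℕ∞) < π.len) (hj : (j : ℕ∞) < π.len) : π.seq i <+: π.seq j ↔ i ≤ j := by
  constructor
  · intro h
    have := h.length_le
    rw [hv.length_seq i hi, hv.length_seq j hj] at this
    omega
  · intro h; exact hv.prefix_seq h hj

theorem prefix_antisymm {a b : Node} (h : a <+: b) (h' : b <+: a) : a = b :=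
  h.eq_of_length (le_antisymm h.length_le h'.length_le)

mutual
theorem trS_sat (hD : ∀ T S, S ∈ Dm T ↔ ∃ π, ValidPath T π ∧ PR π.len ∧ nds π = S) :
    ∀ (φ : CState AP) (V1 : ℕ → Node) (V2 : ℕ → Set Node) (x : ℕ), V1 x ∈ K.T →
      (Sat Dm K V1 V2 (trS φ x) ↔ csat PR K φ (V1 x))
  | .tt, V1, V2, x, hx => by simp [trS, Sat, csat, hx]
  | .atom a, V1, V2, x, hx => by simp [trS, Sat, csat, hx]
  | .not φ, V1, V2, x, hx => by simp only [trS, Sat, csat]; rw [trS_sat hD φ V1 V2 x hx]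
  | .and φ φ', V1, V2, x, hx => by
    simp only [trS, Sat, csat]; rw [trS_sat hD φ V1 V2 x hx, trS_sat hD φ' V1 V2 x hx]
  | .E ψ, V1, V2, x, hx => by
    simp only [trS, Sat, csat, Function.update_self, upd_ne (show x ≠ x + 1 by omega)]
    constructor
    · rintro ⟨S, hS, ⟨h1, h2⟩, h3⟩
      obtain ⟨π, hv, hp, rfl⟩ := (hD _ _).1 hS
      have h0 : π.seq 0 = V1 x := by
        apply prefix_antisymm (hv.zero_prefix h1)
        by_contra hc
        exact h2 ⟨π.seq 0, hv.2.1 0 hv.1, hv.zero_mem, fun h => hc h.2.2⟩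
      refine ⟨π, hv, hp, h0, ?_⟩
      rwa [trP_sat hD ψ V1 _ x π 0 hv hv.1 (by simp) h0.symm] at h3
    · rintro ⟨π, hv, hp, h0, h3⟩
      refine ⟨nds π, (hD _ _).2 ⟨π, hv, hp, rfl⟩, ⟨h0 ▸ hv.zero_mem, ?_⟩, ?_⟩
      · rintro ⟨τ, hτ, h4, h5⟩
        exact h5 ⟨hx, hτ, h0 ▸ hv.zero_prefix h4⟩
      · rwa [trP_sat hD ψ V1 _ x π 0 hv hv.1 (by simp) h0.symm]
  | .D n φ, V1, V2, x, hx => by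
    simp only [trS, csat]
    rw [dF_sat (P := csat PR K φ) (trS_sat hD φ) n 0 V1 hx (by simp)]
    simp
theorem trP_sat (hD : ∀ T S, S ∈ Dm T ↔ ∃ π, ValidPath T π ∧ PR π.len ∧ nds π = S) :
    ∀ (φ : CPath AP) (V1 : ℕ → Node) (V2 : ℕ → Set Node) (x : ℕ) (π : PathW) (i : ℕ),
      ValidPath K.T π → (i : ℕ∞) < π.len → V2 0 = nds π → V1 x = π.seq i →
      (Sat Dm K V1 V2 (trP φ x) ↔ cpsat PR K φ π i)
  | .st φ, V1, V2, x, π, i, hv, hi, h2, h1 => by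
    simp only [trP, cpsat]
    rw [trS_sat hD φ V1 V2 x (h1 ▸ hv.2.1 i hi), h1]
  | .not φ, V1, V2, x, π, i, hv, hi, h2, h1 => by
    simp only [trP, Sat, cpsat]; rw [trP_sat hD φ V1 V2 x π i hv hi h2 h1]
  | .and φ φ', V1, V2, x, π, i, hv, hi, h2, h1 => by
    simp only [trP, Sat, cpsat]
    rw [trP_sat hD φ V1 V2 x π i hv hi h2 h1, trP_sat hD φ' V1 V2 x π i hv hi h2 h1]
  | .X φ, V1, V2, x, π, i, hv, hi, h2, h1 => by
    have hx : V1 x ∈ K.T := h1 ▸ hv.2.1 i hi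
    have e : ∀ τ ∈ K.T, (Sat Dm K (Function.update V1 (x + 1) τ) V2 (chF x (x + 1) (x + 2)) ↔
        childIn K.T (V1 x) τ) := by
      intro τ hτ
      rw [chF_sat (by rw [upd_ne (by omega)]; exact hx) (by simpa using hτ) (by omega) (by omega)]
      rw [upd_ne (by omega), Function.update_self]
    simp only [trP, Sat, cpsat, Function.update_self]
    constructor
    · rintro ⟨τ, hτ, h3, h4, h5⟩
      rw [e τ hτ] at h4
      rw [h2] at h3
      obtain ⟨j, hj, rfl⟩ := h3
      obtain ⟨_, n, hn⟩ := h4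
      have l1 := hv.length_seq j hj
      have l2 := hv.length_seq i hi
      rw [hn, h1] at l1
      simp at l1
      obtain rfl : j = i + 1 := by omega
      refine ⟨hj, ?_⟩
      rwa [trP_sat hD φ _ V2 (x + 1) π (i + 1) hv hj h2 (by simp)] at h5
    · rintro ⟨hj, h5⟩
      refine ⟨π.seq (i + 1), hv.2.1 _ hj, h2 ▸ ⟨_, hj, rfl⟩, ?_, ?_⟩
      · rw [e _ (hv.2.1 _ hj), h1]
        exact ⟨hv.2.1 _ hj, hv.2.2 _ hj⟩
      · rwa [trP_sat hD φ _ V2 (x + 1) π (i + 1) hv hj h2 (by simp)]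
  | .U φ φ', V1, V2, x, π, i, hv, hi, h2, h1 => by
    have hx : V1 x ∈ K.T := h1 ▸ hv.2.1 i hi
    simp only [trP, Sat, cpsat, Function.update_self, upd_ne (show x ≠ x + 1 by omega),
      upd_ne (show x ≠ x + 2 by omega), upd_ne (show x + 1 ≠ x + 2 by omega)]
    constructor
    · rintro ⟨τ, hτ, ⟨h3, h4⟩, h5, h6⟩
      rw [h2] at h4
      obtain ⟨j, hj, rfl⟩ := h4
      have hij : i ≤ j := by
        rw [← hv.prefix_iff hi hj, ← h1]; exact h3.2.2
      rw [trP_sat hD φ' _ V2 (x + 1) π j hv hj h2 (by simp)] at h5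
      refine ⟨j, hij, hj, h5, fun k hk hk' => ?_⟩
      by_contra hc
      have hkl := lt_of_le_lt hk'.le hj
      refine h6 ⟨π.seq k, hv.2.1 k hkl, ⟨hx, hv.2.1 k hkl, h1 ▸ hv.prefix_seq hk hkl⟩,
        ⟨hv.2.1 k hkl, hτ, hv.prefix_seq hk'.le hj⟩, fun h => ?_, ?_⟩
      · have := (hv.prefix_iff hj hkl).1 h.2.2
        omega
      · rwa [trP_sat hD φ _ V2 (x + 2) π k hv hkl h2 (by simp)]
    · rintro ⟨j, hij, hj, h5, h6⟩
      refine ⟨π.seq j, hv.2.1 j hj, ⟨⟨hx, hv.2.1 j hj, h1 ▸ hv.prefix_seq hij hj⟩, h2 ▸ ⟨j, hj, rfl⟩⟩, ?_, ?_⟩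
      · rwa [trP_sat hD φ' _ V2 (x + 1) π j hv hj h2 (by simp)]
      · rintro ⟨σ, hσ, h7, h8, h9, h10⟩
        have a1 := h7.2.2
        rw [h1] at a1
        obtain ⟨k, hk, rfl⟩ := hv.mem_of_prefix ⟨j, hj, rfl⟩ ((hv.prefix_seq (Nat.zero_le i) hi).trans a1) h8.2.2
        rw [trP_sat hD φ _ V2 (x + 2) π k hv hk h2 (by simp)] at h10
        apply h10
        apply h6 k ((hv.prefix_iff hi hk).1 a1)
        by_contra hc
        exact h9 ⟨hv.2.1 j hj, hσ, hv.prefix_seq (by omega) hk⟩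
end

theorem cctl_to_mpl (hD : ∀ T S, S ∈ Dm T ↔ ∃ π, ValidPath T π ∧ PR π.len ∧ nds π = S) (ξ : CState AP) :
    ∃ φ : MSOL AP, φ.IsSentence ∧ ∀ K : KripkeTree AP,
      ((∃ V1 V2, Sat Dm K V1 V2 φ) ↔ CKSat PR K ξ) := by
  refine ⟨.exFO 0 (.and (.not (.exFO 1 (.not (.le 0 1)))) (trS ξ 0)), ⟨?_, ?_⟩, fun K => ?_⟩
  · have := trS_fo ξ 0
    ext w
    have h := @this w
    simp only [MSOL.freeFO, Set.mem_union, Set.mem_singleton_iff, Set.mem_diff, Set.mem_insert_iff,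
      Set.mem_empty_iff_false] at h ⊢
    grind
  · simp [MSOL.freeSO, trS_so]
  have key : ∀ V1 V2, Sat Dm K V1 V2 (.exFO 0 (.and (.not (.exFO 1 (.not (.le 0 1)))) (trS ξ 0))) ↔
      CKSat PR K ξ := by
    intro V1 V2
    simp only [Sat, Function.update_self, upd_ne (show 0 ≠ 1 by omega), CKSat]
    constructor
    · rintro ⟨τ, hτ, h1, h2⟩
      rw [trS_sat hD ξ _ V2 0 (by simpa using hτ), Function.update_self] at h2
      have : τ = K.root := by
        refine prefix_antisymm ?_ (K.rooted.2.1 _ hτ)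
        by_contra hc
        exact h1 ⟨K.root, K.rooted.1, fun h => hc h.2.2⟩
      rwa [← this]
    · intro h
      refine ⟨K.root, K.rooted.1, ?_, ?_⟩
      · rintro ⟨τ, hτ, h1⟩
        exact h1 ⟨K.rooted.1, hτ, K.rooted.2.1 _ hτ⟩
      · rwa [trS_sat hD ξ _ V2 0 (by simpa using K.rooted.1), Function.update_self]
  constructor
  · rintro ⟨V1, V2, h⟩
    exact (key _ _).1 h
  · intro h
    exact ⟨fun _ => [], fun _ => ∅, (key _ _).2 h⟩

theorem prok_full : PROK fullPR := ⟨fun _ => Iff.rfl, trivial⟩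
theorem prok_weak : PROK weakPR := by
  refine ⟨fun l => ?_, by simp [weakPR]⟩
  simp [weakPR]

theorem dom_full (T S : Set Node) : S ∈ MPLdom T ↔ ∃ π, ValidPath T π ∧ fullPR π.len ∧ nds π = S := by
  constructor
  · intro h
    obtain ⟨π, h1, h2⟩ := exists_path_of_set h
    exact ⟨π, h1, trivial, h2⟩
  · rintro ⟨π, h1, _, rfl⟩
    exact h1.isPathOf

theorem dom_weak (T S : Set Node) : S ∈ weakDom MPLdom T ↔
    ∃ π, ValidPath T π ∧ weakPR π.len ∧ nds π = S := by
  constructor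
  · rintro ⟨h, hf⟩
    obtain ⟨π, h1, rfl⟩ := exists_path_of_set h
    exact ⟨π, h1, h1.finite_iff.1 hf, rfl⟩
  · rintro ⟨π, h1, h2, rfl⟩
    exact ⟨h1.isPathOf, h1.finite_iff.2 h2⟩
end
end Dec

/-- MPL ≡ CCTL* and WMPL ≡ WCCTL* over the class of all Kripke
trees. -/
theorem stmt2 (AP : Type) [Fintype AP] :
    ((∀ φ : MSOL AP, φ.IsSentence →
        ∃ ξ : CState AP, ∀ K : KripkeTree AP,
          ((MPL AP).KSat K φ ↔ CKSat fullPR K ξ)) ∧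
     (∀ ξ : CState AP,
        ∃ φ : MSOL AP, φ.IsSentence ∧ ∀ K : KripkeTree AP,
          ((MPL AP).KSat K φ ↔ CKSat fullPR K ξ))) ∧
    ((∀ φ : MSOL AP, φ.IsSentence →
        ∃ ξ : CState AP, ∀ K : KripkeTree AP,
          ((WMPL AP).KSat K φ ↔ CKSat weakPR K ξ)) ∧
     (∀ ξ : CState AP,
        ∃ φ : MSOL AP, φ.IsSentence ∧ ∀ K : KripkeTree AP,
          ((WMPL AP).KSat K φ ↔ CKSat weakPR K ξ))) := by
  exact ⟨⟨fun φ hφ => mpl_to_cctl prok_full dom_full φ hφ, fun ξ => cctl_to_mpl dom_full ξ⟩,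
    ⟨fun φ hφ => mpl_to_cctl prok_weak dom_weak φ hφ, fun ξ => cctl_to_mpl dom_weak ξ⟩⟩
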